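/- arXiv:2108.08746 — 3 statements merged into one kernel-verified Lean document; each statement's English description precedes it below -/
import Mathlib

section
/- Let n ≥ 2 be an integer and define V(s) = ∫₀^s (sinh u)^{n−1} du for s ≥ 0 (so that the volume of a geodesic ball of radius s in hyperbolic n-space equals |S^{n−1}|·V(s)). Then for all 0 < r ≤ R one has (R/r)^n ≤ V(R)/V(r) ≤ 𝒟·(R/r)^{log₂ 𝒟}, where 𝒟 = 2^n · (cosh(2R))^{n−1}. -/
open MeasureTheory

lemma aux_sinh_le (x : ℝ) (hx : 0 ≤ x) : Real.sinh x ≤ x * Real.cosh x := by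
  have hd : ∀ y : ℝ, HasDerivAt (fun y => y * Real.cosh y - Real.sinh y)
      (1 * Real.cosh y + y * Real.sinh y - Real.cosh y) y := fun y =>
    ((hasDerivAt_id y).mul (Real.hasDerivAt_cosh y)).sub (Real.hasDerivAt_sinh y)
  have hm : MonotoneOn (fun y => y * Real.cosh y - Real.sinh y) (Set.Ici 0) := by
    apply monotoneOn_of_deriv_nonneg (convex_Ici 0)
    · exact fun y _ => (hd y).continuousAt.continuousWithinAt
    · exact fun y _ => (hd y).differentiableAt.differentiableWithinAt
    · intro y hy
      rw [interior_Ici] at hy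
      have hy' : 0 ≤ y := le_of_lt hy
      rw [(hd y).deriv]
      have := mul_nonneg hy' (Real.sinh_nonneg_iff.2 hy')
      linarith
  have := hm (Set.mem_Ici.2 le_rfl) (Set.mem_Ici.2 hx) hx
  simp at this
  linarith

lemma aux_le_sinh (l x : ℝ) (hl : 1 ≤ l) (hx : 0 ≤ x) :
    l * Real.sinh x ≤ Real.sinh (l * x) := by
  have hd : ∀ y : ℝ, HasDerivAt (fun y => Real.sinh (l * y) - l * Real.sinh y)
      (Real.cosh (l * y) * (l * 1) - l * Real.cosh y) y := fun y =>
    (((hasDerivAt_id y).const_mul l).sinh).sub ((Real.hasDerivAt_sinh y).const_mul l)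
  have hm : MonotoneOn (fun y => Real.sinh (l * y) - l * Real.sinh y) (Set.Ici 0) := by
    apply monotoneOn_of_deriv_nonneg (convex_Ici 0)
    · exact fun y _ => (hd y).continuousAt.continuousWithinAt
    · exact fun y _ => (hd y).differentiableAt.differentiableWithinAt
    · intro y hy
      rw [interior_Ici] at hy
      have hy' : 0 ≤ y := le_of_lt hy
      rw [(hd y).deriv]
      have h1 : Real.cosh y ≤ Real.cosh (l * y) := by
        rw [Real.cosh_le_cosh, abs_of_nonneg hy', abs_of_nonneg (by positivity)]
        nlinarith
      nlinarith
  have := hm (Set.mem_Ici.2 le_rfl) (Set.mem_Ici.2 hx) hx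
  simp at this
  linarith

/-- Bishop–Gromov type volume comparison for hyperbolic balls.
`V s = ∫₀^s (sinh u)^{n-1} du` is the normalized volume of a geodesic ball of radius `s`
in hyperbolic `n`-space. For `0 < r ≤ R`,
`(R/r)^n ≤ V R / V r ≤ 𝒟 (R/r)^{log₂ 𝒟}` with `𝒟 = 2^n (cosh 2R)^{n-1}`. -/
theorem volume_doubling_hyperbolic (n : ℕ) (hn : 2 ≤ n) (V : ℝ → ℝ)
    (hV : ∀ s : ℝ, V s = ∫ u in (0:ℝ)..s, (Real.sinh u) ^ (n - 1))
    (r R : ℝ) (hr : 0 < r) (hrR : r ≤ R) :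
    (R / r) ^ n ≤ V R / V r ∧
      V R / V r ≤ ((2:ℝ) ^ n * Real.cosh (2 * R) ^ (n - 1)) *
        (R / r) ^ Real.logb 2 ((2:ℝ) ^ n * Real.cosh (2 * R) ^ (n - 1)) := by
  obtain ⟨m, rfl⟩ : ∃ m, n = m + 1 := ⟨n - 1, by omega⟩
  simp only [Nat.add_sub_cancel] at hV ⊢
  have hR : 0 < R := hr.trans_le hrR
  obtain ⟨l, hl⟩ : ∃ l, l = R / r := ⟨_, rfl⟩
  have hl1 : 1 ≤ l := by rw [hl]; exact (one_le_div hr).2 hrR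
  have hlr : l * r = R := by rw [hl]; field_simp
  rw [← hl]
  have hcont : Continuous fun u : ℝ => Real.sinh u ^ m := Real.continuous_sinh.pow m
  have hcont2 : Continuous fun u : ℝ => Real.sinh (l * u) ^ m :=
    (Real.continuous_sinh.comp (continuous_const.mul continuous_id)).pow m
  have hVr : 0 < V r := by
    rw [hV]
    apply intervalIntegral.intervalIntegral_pos_of_pos_on (hcont.intervalIntegrable _ _) _ hr
    intro x hx
    exact pow_pos (Real.sinh_pos_iff.2 hx.1) m
  have hVR : V R = l * ∫ u in (0:ℝ)..r, Real.sinh (l * u) ^ m := by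
    have := intervalIntegral.mul_integral_comp_mul_left (a := 0) (b := r)
      (f := fun u => Real.sinh u ^ m) l
    rw [this, hV, hlr, mul_zero]
  have hl0 : 0 ≤ l := by linarith
  have hlow : l ^ m * V r ≤ ∫ u in (0:ℝ)..r, Real.sinh (l * u) ^ m := by
    rw [hV, ← intervalIntegral.integral_const_mul]
    apply intervalIntegral.integral_mono_on hr.le
      ((continuous_const.mul hcont).intervalIntegrable _ _) (hcont2.intervalIntegrable _ _)
    intro x hx
    simp only [Pi.mul_apply]
    rw [← mul_pow]
    exact pow_le_pow_left₀ (mul_nonneg hl0 (Real.sinh_nonneg_iff.2 hx.1))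
      (aux_le_sinh l x hl1 hx.1) m
  have hup : ∫ u in (0:ℝ)..r, Real.sinh (l * u) ^ m ≤ (l * Real.cosh (2 * R)) ^ m * V r := by
    rw [hV, ← intervalIntegral.integral_const_mul]
    apply intervalIntegral.integral_mono_on hr.le (hcont2.intervalIntegrable _ _)
      ((continuous_const.mul hcont).intervalIntegrable _ _)
    intro x hx
    have hlx : 0 ≤ l * x := mul_nonneg hl0 hx.1
    simp only [Pi.mul_apply]
    rw [← mul_pow]
    apply pow_le_pow_left₀ (Real.sinh_nonneg_iff.2 hlx)
    have hc : Real.cosh (l * x) ≤ Real.cosh (2 * R) := by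
      rw [Real.cosh_le_cosh, abs_of_nonneg hlx, abs_of_nonneg (by positivity)]
      have := mul_le_mul_of_nonneg_left hx.2 hl0
      linarith
    calc Real.sinh (l * x) ≤ l * x * Real.cosh (l * x) := aux_sinh_le _ hlx
      _ ≤ l * Real.sinh x * Real.cosh (2 * R) := by
        apply mul_le_mul _ hc (Real.cosh_pos _).le
          (mul_nonneg hl0 (Real.sinh_nonneg_iff.2 hx.1))
        exact mul_le_mul_of_nonneg_left (Real.self_le_sinh_iff.2 hx.1) hl0
      _ = _ := by ring
  have hC : 1 ≤ Real.cosh (2 * R) ^ m := one_le_pow₀ (Real.one_le_cosh _)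
  have h2 : (1:ℝ) ≤ 2 ^ (m + 1) := one_le_pow₀ (by norm_num)
  constructor
  · rw [le_div_iff₀ hVr, hVR]
    calc l ^ (m + 1) * V r = l * (l ^ m * V r) := by ring
      _ ≤ _ := mul_le_mul_of_nonneg_left hlow hl0
  · rw [div_le_iff₀ hVr, hVR]
    have hlog : l ^ (m + 1) ≤ l ^ Real.logb 2 ((2:ℝ) ^ (m + 1) * Real.cosh (2 * R) ^ m) := by
      rw [← Real.rpow_natCast l (m + 1)]
      apply Real.rpow_le_rpow_of_exponent_le hl1
      rw [Real.le_logb_iff_rpow_le (by norm_num) (by positivity), Real.rpow_natCast]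
      exact le_mul_of_one_le_right (by positivity) hC
    calc _ ≤ l * ((l * Real.cosh (2 * R)) ^ m * V r) := mul_le_mul_of_nonneg_left hup hl0
      _ = Real.cosh (2 * R) ^ m * l ^ (m + 1) * V r := by ring
      _ ≤ _ := by
        apply mul_le_mul_of_nonneg_right _ hVr.le
        apply mul_le_mul _ hlog (by positivity) (by positivity)
        exact le_mul_of_one_le_left (by positivity) h2
end

section
/- Let γ ∈ (0,1). For every R > 0, I_{0,γ}(R) = 4π ∫₀^R ρ² K_γ(ρ) sinh²ρ dρ equals (2^γ R^{3−γ} / ((1−γ)|Γ(−γ)|)) · ( I_{1/2}(R) K_{3/2+γ}(R) + I_{3/2}(R) K_{1/2+γ}(R) ) − (2^γ R^{3−γ} / ((1−γ)(2−γ)|Γ(−γ)|)) · ( I_{3/2}(R) K_{1/2+γ}(R) + I_{5/2}(R) K_{γ−1/2}(R) ). -/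
open MeasureTheory

/-- Modified Bessel function of the second kind:
`K_ν(x) = ∫₀^∞ exp(−x cosh s) cosh(ν s) ds` (so `K_{−ν} = K_ν`). -/
noncomputable def besselK (ν x : ℝ) : ℝ :=
  ∫ s in Set.Ioi (0 : ℝ), Real.exp (-x * Real.cosh s) * Real.cosh (ν * s)

/-- Modified Bessel function of the first kind:
`I_ν(x) = Σ_{j≥0} (x/2)^{2j+ν}/(j! Γ(ν+j+1))`. -/
noncomputable def besselI (ν x : ℝ) : ℝ :=
  ∑' j : ℕ, (x / 2) ^ (2 * (j : ℝ) + ν) / ((j.factorial : ℝ) * Real.Gamma (ν + j + 1))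

/-- Normalizing constant `C(3,γ) = 2^{2γ} Γ(3/2+γ)/(π^{3/2} |Γ(−γ)|)`. -/
noncomputable def C3 (γ : ℝ) : ℝ :=
  2 ^ (2 * γ) * Real.Gamma (3 / 2 + γ) / (Real.pi ^ ((3 : ℝ) / 2) * |Real.Gamma (-γ)|)

/-- The kernel
`K_γ(ρ) = C(3,γ) (sinh ρ)⁻¹ ρ^{−1/2−γ} · 2 K_{3/2+γ}(ρ) / (Γ(3/2+γ) 2^{3/2+γ})`. -/
noncomputable def Kker (γ ρ : ℝ) : ℝ :=
  C3 γ * (Real.sinh ρ)⁻¹ * ρ ^ (-(1 / 2 : ℝ) - γ) * (2 * besselK (3 / 2 + γ) ρ) /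
    (Real.Gamma (3 / 2 + γ) * 2 ^ ((3 : ℝ) / 2 + γ))

/-- Scale function `I_{0,γ}(R) = 4π ∫₀^R ρ² K_γ(ρ) sinh²ρ dρ`. -/
noncomputable def scaleI0 (γ R : ℝ) : ℝ :=
  4 * Real.pi * ∫ ρ in (0 : ℝ)..R, ρ ^ 2 * Kker γ ρ * (Real.sinh ρ) ^ 2

/-- Scale function `I_{∞,γ}(R) = 4π R² ∫_R^∞ K_γ(ρ) sinh²ρ dρ`. -/
noncomputable def scaleIinf (γ R : ℝ) : ℝ :=
  4 * Real.pi * R ^ 2 * ∫ ρ in Set.Ioi R, Kker γ ρ * (Real.sinh ρ) ^ 2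

section Helpers

open Real Set Filter Topology

lemma bk_exp_neg_le {p y : ℝ} (hp : 0 < p) (hy : 0 < y) : exp (-y) ≤ p ^ p * y ^ (-p) := by
  have h1 : y / p ≤ exp (y / p) := by linarith [add_one_le_exp (y / p)]
  have h2 : (y / p) ^ p ≤ exp y := by
    have := rpow_le_rpow (by positivity) h1 hp.le
    rwa [← exp_mul, div_mul_cancel₀ _ hp.ne'] at this
  rw [div_rpow hy.le hp.le] at h2
  rw [exp_neg, rpow_neg hy.le, ← div_eq_mul_inv]
  have hpp : 0 < p ^ p := rpow_pos_of_pos hp p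
  have hyp : 0 < y ^ p := rpow_pos_of_pos hy p
  rw [div_le_iff₀ hpp] at h2
  rw [inv_le_iff_one_le_mul₀ (exp_pos y), div_mul_eq_mul_div, le_div_iff₀ hyp]
  linarith

lemma bk_dom {p x s : ℝ} (hp : 0 < p) (hx : 0 < x) :
    exp (-x * cosh s) ≤ p ^ p * (x / 2) ^ (-p) * exp (-p * s) := by
  have hz : 0 < x / 2 * exp s := by positivity
  have h1 : exp (-x * cosh s) ≤ exp (-(x / 2 * exp s)) := by
    apply exp_le_exp.mpr
    rw [cosh_eq]
    nlinarith [exp_pos (-s)]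
  refine h1.trans ((bk_exp_neg_le hp hz).trans (le_of_eq ?_))
  rw [mul_rpow (by positivity) (exp_pos s).le, ← exp_mul]
  ring_nf

lemma bk_int_exp {x : ℝ} (hx : 0 < x) (a : ℝ) :
    IntegrableOn (fun s => exp (-x * cosh s) * exp (a * s)) (Ioi 0) := by
  have hp : 0 < |a| + 1 := by positivity
  have h1 := ((exp_neg_integrableOn_Ioi 0 (b := |a| + 1 - a) (by linarith [le_abs_self a]))).const_mul
    ((|a| + 1) ^ (|a| + 1) * (x / 2) ^ (-(|a| + 1)))
  refine Integrable.mono' h1 (by fun_prop) (Eventually.of_forall fun s => ?_)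
  rw [norm_of_nonneg (by positivity)]
  calc _ ≤ ((|a| + 1) ^ (|a| + 1) * (x / 2) ^ (-(|a| + 1)) * exp (-(|a| + 1) * s)) * exp (a * s) := by
        gcongr
        exact bk_dom hp hx
    _ = _ := by
        rw [mul_assoc, ← exp_add]; ring_nf

lemma bk_int_cosh {x : ℝ} (hx : 0 < x) (ν : ℝ) :
    IntegrableOn (fun s => exp (-x * cosh s) * cosh (ν * s)) (Ioi 0) := by
  have := ((bk_int_exp hx ν).add (bk_int_exp hx (-ν))).div_const 2
  refine this.congr (Eventually.of_forall fun s => ?_)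
  simp only [Pi.add_apply, cosh_eq (ν * s)]
  ring_nf

lemma bk_nonneg (ν x : ℝ) : 0 ≤ besselK ν x :=
  integral_nonneg fun s => mul_nonneg (exp_pos _).le (cosh_pos _).le

lemma bk_cosh_le {ν s : ℝ} (hs : 0 ≤ s) : cosh (ν * s) ≤ exp (|ν| * s) := by
  rw [← cosh_abs, abs_mul, abs_of_nonneg hs, cosh_eq]
  have : exp (-(|ν| * s)) ≤ exp (|ν| * s) := exp_le_exp.mpr (by nlinarith [abs_nonneg ν, mul_nonneg (abs_nonneg ν) hs])
  linarith

lemma bk_bound {ν p : ℝ} (hp : |ν| < p) : ∃ C : ℝ, 0 ≤ C ∧ ∀ x, 0 < x → besselK ν x ≤ C * x ^ (-p) := by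
  have hp0 : 0 < p := (abs_nonneg ν).trans_lt hp
  have hq : 0 < p - |ν| := by linarith
  refine ⟨p ^ p * 2 ^ p * ∫ s in Ioi (0 : ℝ), exp (-(p - |ν|) * s), ?_, fun x hx => ?_⟩
  · have : 0 ≤ ∫ s in Ioi (0 : ℝ), exp (-(p - |ν|) * s) := integral_nonneg fun s => (exp_pos _).le
    positivity
  have h1 := (exp_neg_integrableOn_Ioi 0 hq).const_mul (p ^ p * (x / 2) ^ (-p))
  have h2 : besselK ν x ≤ ∫ s in Ioi (0 : ℝ), p ^ p * (x / 2) ^ (-p) * exp (-(p - |ν|) * s) := by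
    refine setIntegral_mono_on (bk_int_cosh hx ν) h1 measurableSet_Ioi fun s hs => ?_
    calc _ ≤ (p ^ p * (x / 2) ^ (-p) * exp (-p * s)) * exp (|ν| * s) := by
          gcongr
          · exact bk_dom hp0 hx
          · exact bk_cosh_le (le_of_lt hs)
      _ = _ := by
          rw [mul_assoc, ← exp_add]; ring_nf
  refine h2.trans (le_of_eq ?_)
  rw [integral_const_mul, div_rpow hx.le (by norm_num), rpow_neg (by norm_num : (0:ℝ) ≤ 2)]
  field_simp

lemma bk_deriv0 {x : ℝ} (hx : 0 < x) (ν : ℝ) :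
    HasDerivAt (besselK ν) (-(besselK (ν + 1) x + besselK (ν - 1) x) / 2) x := by
  have key : ∀ y s : ℝ, exp (-y * cosh s) * cosh s * cosh (ν * s) =
      (exp (-y * cosh s) * cosh ((ν + 1) * s) + exp (-y * cosh s) * cosh ((ν - 1) * s)) / 2 := by
    intro y s
    rw [show (ν + 1) * s = ν * s + s by ring, show (ν - 1) * s = ν * s - s by ring, cosh_add, cosh_sub]
    ring
  have hi : ∀ y, 0 < y → Integrable (fun s => exp (-y * cosh s) * cosh s * cosh (ν * s))
      (volume.restrict (Ioi 0)) := by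
    intro y hy
    simp_rw [key]
    exact ((bk_int_cosh hy (ν + 1)).add (bk_int_cosh hy (ν - 1))).div_const 2
  have := (hasDerivAt_integral_of_dominated_loc_of_deriv_le (μ := volume.restrict (Ioi (0:ℝ)))
    (F := fun y s => exp (-y * cosh s) * cosh (ν * s)) (x₀ := x) (s := Ioi (x / 2))
    (F' := fun y s => -(exp (-y * cosh s) * cosh s * cosh (ν * s)))
    (bound := fun s => exp (-(x / 2) * cosh s) * cosh s * cosh (ν * s))
    (Ioi_mem_nhds (by linarith)) (Eventually.of_forall fun y => by fun_prop)
    (bk_int_cosh hx ν) (by fun_prop) (Eventually.of_forall fun s y hy => ?_) (hi _ (by linarith))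
    (Eventually.of_forall fun s y hy => ?_)).2
  · refine HasDerivAt.congr_deriv (f := besselK ν) this ?_
    simp_rw [key]
    rw [integral_neg, integral_div, integral_add (bk_int_cosh hx (ν + 1)) (bk_int_cosh hx (ν - 1))]
    simp only [besselK]
    ring
  · have h1 := cosh_pos s
    have h2 := cosh_pos (ν * s)
    rw [norm_neg, norm_of_nonneg (by positivity)]
    have : x / 2 < y := hy
    gcongr
  · have h := (((hasDerivAt_id y).neg.mul_const (cosh s)).exp).mul_const (cosh (ν * s))
    refine h.congr_deriv ?_
    simp

lemma bk_rec {x : ℝ} (hx : 0 < x) (ν : ℝ) :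
    x * (besselK (ν + 1) x - besselK (ν - 1) x) = 2 * ν * besselK ν x := by
  have key : ∀ s : ℝ, exp (-x * cosh s) * (-x * sinh s) * sinh (ν * s) + exp (-x * cosh s) * (cosh (ν * s) * ν) =
      -(x / 2) * (exp (-x * cosh s) * cosh ((ν + 1) * s) - exp (-x * cosh s) * cosh ((ν - 1) * s))
      + ν * (exp (-x * cosh s) * cosh (ν * s)) := by
    intro s
    rw [show (ν + 1) * s = ν * s + s by ring, show (ν - 1) * s = ν * s - s by ring, cosh_add, cosh_sub]
    ring
  have i1 := bk_int_cosh hx (ν + 1)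
  have i2 := bk_int_cosh hx (ν - 1)
  have i3 := bk_int_cosh hx ν
  have hd : ∀ s ∈ Ici (0:ℝ), HasDerivAt (fun s => exp (-x * cosh s) * sinh (ν * s))
      (exp (-x * cosh s) * (-x * sinh s) * sinh (ν * s) + exp (-x * cosh s) * (cosh (ν * s) * ν)) s := by
    intro s _
    have h1 := ((hasDerivAt_cosh s).const_mul (-x)).exp
    have h2 := ((hasDerivAt_id s).const_mul ν).sinh
    refine (h1.mul h2).congr_deriv ?_
    simp
  have ht : Tendsto (fun s => exp (-x * cosh s) * sinh (ν * s)) atTop (𝓝 0) := by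
    have hp : 0 < |ν| + 1 := by positivity
    have h0 : Tendsto (fun s => ((|ν| + 1) ^ (|ν| + 1) * (x / 2) ^ (-(|ν| + 1))) * exp (-s)) atTop (𝓝 0) := by
      simpa using (tendsto_exp_neg_atTop_nhds_zero).const_mul ((|ν| + 1) ^ (|ν| + 1) * (x / 2) ^ (-(|ν| + 1)))
    refine squeeze_zero_norm' ?_ h0
    filter_upwards [eventually_ge_atTop 0] with s hs
    rw [norm_mul, norm_of_nonneg (exp_pos _).le, norm_eq_abs]
    have h3 : |sinh (ν * s)| ≤ exp (|ν| * s) := by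
      refine le_trans ?_ (bk_cosh_le hs)
      rw [abs_le]
      constructor <;> rw [cosh_eq, sinh_eq] <;> linarith [exp_pos (ν * s), exp_pos (-(ν * s))]
    calc _ ≤ ((|ν| + 1) ^ (|ν| + 1) * (x / 2) ^ (-(|ν| + 1)) * exp (-(|ν| + 1) * s)) * exp (|ν| * s) := by
          gcongr
          exact bk_dom hp hx
      _ = _ := by
          rw [mul_assoc, ← exp_add]; ring_nf
  have hint : IntegrableOn (fun s => exp (-x * cosh s) * (-x * sinh s) * sinh (ν * s)
      + exp (-x * cosh s) * (cosh (ν * s) * ν)) (Ioi 0) := by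
    simp_rw [key]
    exact ((i1.sub i2).const_mul _).add (i3.const_mul _)
  have := integral_Ioi_of_hasDerivAt_of_tendsto' hd hint ht
  simp_rw [key] at this
  rw [integral_add (f := fun s => -(x / 2) * (exp (-x * cosh s) * cosh ((ν + 1) * s) - exp (-x * cosh s) * cosh ((ν - 1) * s)))
    ((i1.sub i2).const_mul _) (i3.const_mul _), integral_const_mul, integral_const_mul,
    integral_sub i1 i2] at this
  simp only [besselK]
  simp at this
  simp only [neg_mul] 
  linarith

lemma bk_deriv1 {x : ℝ} (hx : 0 < x) (ν : ℝ) :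
    HasDerivAt (besselK ν) (-besselK (ν - 1) x - ν / x * besselK ν x) x := by
  refine (bk_deriv0 hx ν).congr_deriv ?_
  have := bk_rec hx ν
  field_simp
  linarith

lemma bk_deriv2 {x : ℝ} (hx : 0 < x) (ν : ℝ) :
    HasDerivAt (besselK ν) (-besselK (ν + 1) x + ν / x * besselK ν x) x := by
  refine (bk_deriv0 hx ν).congr_deriv ?_
  have := bk_rec hx ν
  field_simp
  linarith

lemma bi_congr {f g : ℕ → ℝ} {a b : ℝ} (h : HasSum f a) (h1 : ∀ j, g j = f j) (h2 : b = a) :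
    HasSum g b := by
  rw [h2, funext h1]; exact h

lemma bi_gamma (j : ℕ) : (j.factorial : ℝ) * Gamma ((1:ℝ) / 2 + j + 1) =
    ((2 * j + 1).factorial : ℝ) * √π / (2 * 2 ^ (2 * j)) := by
  have h := Real.Gamma_mul_Gamma_add_half ((j : ℝ) + 1)
  rw [Gamma_nat_eq_factorial, show 2 * ((j:ℝ) + 1) = ((2 * j + 1 : ℕ) : ℝ) + 1 by push_cast; ring,
    Gamma_nat_eq_factorial] at h
  rw [show (1:ℝ) / 2 + j + 1 = (j:ℝ) + 1 + 1 / 2 by ring, h,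
    show (1:ℝ) - (((2 * j + 1 : ℕ) : ℝ) + 1) = -((2 * j + 1 : ℕ) : ℝ) by push_cast; ring,
    rpow_neg (by norm_num), rpow_natCast]
  field_simp
  ring

lemma bi_half {x : ℝ} (hx : 0 < x) :
    HasSum (fun j : ℕ => (x / 2) ^ (2 * (j : ℝ) + 1 / 2) / ((j.factorial : ℝ) * Gamma (1 / 2 + j + 1)))
      (√2 / √π * x ^ (-(1/2) : ℝ) * sinh x) := by
  have hpi : (0:ℝ) < √π := by positivity
  refine bi_congr ((hasSum_sinh x).mul_left (√2 / √π * x ^ (-(1/2) : ℝ))) (fun j => ?_) rfl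
  rw [bi_gamma, rpow_add (by positivity), show 2 * (j:ℝ) = ((2 * j : ℕ) : ℝ) by push_cast; ring,
    rpow_natCast, ← sqrt_eq_rpow, sqrt_div hx.le, rpow_neg hx.le, ← sqrt_eq_rpow]
  have h1 : 0 < √x := sqrt_pos.mpr hx
  have h2 : √x ^ 2 = x := sq_sqrt hx.le
  have h3 : (√2:ℝ) ^ 2 = 2 := sq_sqrt (by norm_num)
  have h4 : ((2 * j + 1).factorial : ℝ) ≠ 0 := by positivity
  rw [pow_succ x (2 * j), div_pow]
  field_simp
  rw [h2, h3]
  ring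

lemma bi_three {x : ℝ} (hx : 0 < x) :
    HasSum (fun j : ℕ => (x / 2) ^ (2 * (j : ℝ) + 3 / 2) / ((j.factorial : ℝ) * Gamma (3 / 2 + j + 1)))
      (√2 / √π * x ^ (-(1/2) : ℝ) * (cosh x - sinh x / x)) := by
  have h0 := ((hasSum_cosh x).sub ((hasSum_sinh x).div_const x))
  rw [← hasSum_nat_add_iff' 1] at h0
  have hpi : (0:ℝ) < √π := by positivity
  refine bi_congr (h0.mul_left (√2 / √π * x ^ (-(1/2) : ℝ))) (fun j => ?_) ?_
  · rw [show (3:ℝ) / 2 + j + 1 = (1 / 2 + j + 1) + 1 by ring, Gamma_add_one (by positivity),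
      show (j.factorial : ℝ) * ((1 / 2 + j + 1) * Gamma (1 / 2 + j + 1)) =
        (1 / 2 + j + 1) * ((j.factorial : ℝ) * Gamma (1 / 2 + j + 1)) by ring,
      bi_gamma, show 2 * (j:ℝ) + 3 / 2 = ((2 * j + 1 : ℕ):ℝ) + 1 / 2 by push_cast; ring,
      rpow_add (by positivity), 
      rpow_natCast, ← sqrt_eq_rpow, sqrt_div hx.le, rpow_neg hx.le, ← sqrt_eq_rpow]
    have h1 : 0 < √x := sqrt_pos.mpr hx
    have h2 : √x ^ 2 = x := sq_sqrt hx.le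
    have h3 : (√2:ℝ) ^ 2 = 2 := sq_sqrt (by norm_num)
    have h4 : ((2 * j + 1).factorial : ℝ) ≠ 0 := by positivity
    rw [show 2 * (j + 1) + 1 = (2 * j + 1) + 1 + 1 by ring, show 2 * (j + 1) = (2 * j + 1) + 1 by ring]
    simp only [Nat.factorial_succ (2 * j + 1), Nat.factorial_succ (2 * j + 1 + 1)]
    push_cast
    rw [div_pow]
    have h5 : (2 * (j:ℝ) + 1 + 1) ≠ 0 := by positivity
    have h6 : (2 * (j:ℝ) + 1 + 1 + 1) ≠ 0 := by positivity
    have h7 : (1 + 2 * (j:ℝ) + 2) ≠ 0 := by positivity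
    field_simp
    rw [h2, h3]
    ring
  · simp [hx.ne']

lemma bi_five {x : ℝ} (hx : 0 < x) :
    HasSum (fun j : ℕ => (x / 2) ^ (2 * (j : ℝ) + 5 / 2) / ((j.factorial : ℝ) * Gamma (5 / 2 + j + 1)))
      (√2 / √π * x ^ (-(1/2) : ℝ) * (sinh x - 3 / x * (cosh x - sinh x / x))) := by
  have h0 := ((bi_half hx).sub ((bi_three hx).mul_left (3 / x)))
  rw [← hasSum_nat_add_iff' 1] at h0
  refine bi_congr h0 (fun j => ?_) ?_
  · have e1 : Gamma ((5:ℝ) / 2 + j + 1) = (j + 5 / 2) * ((j + 3 / 2) * Gamma (1 / 2 + j + 1)) := by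
      rw [show (5:ℝ) / 2 + j + 1 = ((1 / 2 + j + 1) + 1) + 1 by ring, Gamma_add_one (by positivity),
        Gamma_add_one (by positivity)]
      ring
    have e2 : Gamma ((1:ℝ) / 2 + (j + 1 : ℕ) + 1) = ((j + 3 / 2) * Gamma (1 / 2 + j + 1)) := by
      rw [show (1:ℝ) / 2 + (j + 1 : ℕ) + 1 = ((1 / 2 + j + 1) + 1) by push_cast; ring, Gamma_add_one (by positivity)]
      ring
    have e3 : Gamma ((3:ℝ) / 2 + (j + 1 : ℕ) + 1) = (j + 5 / 2) * ((j + 3 / 2) * Gamma (1 / 2 + j + 1)) := by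
      rw [← e1]; push_cast; ring_nf
    have hG : 0 < Gamma ((1:ℝ) / 2 + j + 1) := Gamma_pos_of_pos (by positivity)
    rw [e1, e2, e3]
    have r1 : (x / 2) ^ (2 * ((j + 1 : ℕ) : ℝ) + 1 / 2) = (x / 2) ^ (2 * (j : ℝ) + 5 / 2) := by
      push_cast; ring_nf
    have r2 : (x / 2) ^ (2 * ((j + 1 : ℕ) : ℝ) + 3 / 2) = (x / 2) ^ (2 * (j : ℝ) + 5 / 2) * (x / 2) := by
      rw [← rpow_add_one (by positivity)]; push_cast; ring_nf
    rw [r1, r2, Nat.factorial_succ]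
    push_cast
    have hj : (j.factorial : ℝ) ≠ 0 := by positivity
    have a1 : (j:ℝ) + 1 ≠ 0 := by positivity
    have a2 : 2 * (j:ℝ) + 5 ≠ 0 := by positivity
    have a3 : 2 * (j:ℝ) + 3 ≠ 0 := by positivity
    field_simp
    ring
  · have e3 : Gamma ((3:ℝ) / 2 + 1) = (3 / 2) * Gamma (1 / 2 + 1) := by
      rw [Gamma_add_one (by norm_num)]; norm_num
    have hG : 0 < Gamma ((1:ℝ) / 2 + 1) := Gamma_pos_of_pos (by norm_num)
    have r2 : (x / 2) ^ ((3:ℝ) / 2) = (x / 2) ^ ((1:ℝ) / 2) * (x / 2) := by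
      rw [← rpow_add_one (by positivity)]; norm_num
    simp only [Finset.range_one, Finset.sum_singleton, Nat.cast_zero, mul_zero, zero_add, add_zero, r2, e3,
      Nat.factorial_zero, Nat.cast_one, one_mul]
    field_simp
    ring

/-- The antiderivative (up to a constant), written with elementary functions. -/
noncomputable def bPhi (γ x : ℝ) : ℝ :=
  x ^ (5 / 2 - γ) * ((2 - γ) * (sinh x * besselK (3 / 2 + γ) x
      + (cosh x - sinh x / x) * besselK (1 / 2 + γ) x)
    - ((cosh x - sinh x / x) * besselK (1 / 2 + γ) x
      + (sinh x - 3 / x * (cosh x - sinh x / x)) * besselK (γ - 1 / 2) x))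

lemma bPhi_deriv (γ : ℝ) {x : ℝ} (hx : 0 < x) :
    HasDerivAt (bPhi γ) (2 * (1 - γ) * (2 - γ) * (x ^ (3 / 2 - γ) * sinh x * besselK (3 / 2 + γ) x)) x := by
  have k2 := bk_deriv1 hx (3 / 2 + γ)
  rw [show 3 / 2 + γ - 1 = 1 / 2 + γ by ring] at k2
  have k1 := bk_deriv1 hx (1 / 2 + γ)
  have k1' := bk_deriv2 hx (1 / 2 + γ)
  have k0 := bk_deriv2 hx (γ - 1 / 2)
  rw [show 1 / 2 + γ - 1 = γ - 1 / 2 by ring] at k1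
  rw [show 1 / 2 + γ + 1 = 3 / 2 + γ by ring] at k1'
  rw [show γ - 1 / 2 + 1 = 1 / 2 + γ by ring] at k0
  have hk := k1.unique k1'
  have i1 := hasDerivAt_sinh x
  have i3 : HasDerivAt (fun x => cosh x - sinh x / x) (sinh x - (cosh x - sinh x / x) / x) x := by
    refine ((hasDerivAt_cosh x).sub ((hasDerivAt_sinh x).div (hasDerivAt_id x) hx.ne')).congr_deriv ?_
    simp only [id]
    field_simp
  have i5 : HasDerivAt (fun x => sinh x - 3 / x * (cosh x - sinh x / x))
      ((cosh x - sinh x / x) - 2 / x * (sinh x - 3 / x * (cosh x - sinh x / x))) x := by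
    refine ((hasDerivAt_sinh x).sub (((hasDerivAt_const x (3:ℝ)).div (hasDerivAt_id x) hx.ne').mul i3)).congr_deriv ?_
    simp only [id, Pi.div_apply]
    field_simp
    ring
  have hp := hasDerivAt_rpow_const (x := x) (p := 5 / 2 - γ) (Or.inl hx.ne')
  rw [show 5 / 2 - γ - 1 = 3 / 2 - γ by ring] at hp
  have hpow : x ^ (5 / 2 - γ) = x ^ (3 / 2 - γ) * x := by
    rw [← rpow_add_one hx.ne']; ring_nf
  have := hp.mul ((((i1.mul k2).add (i3.mul k1)).const_mul (2 - γ)).sub ((i3.mul k1).add (i5.mul k0)))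
  refine HasDerivAt.congr_deriv (f := bPhi γ) this ?_
  simp only [Pi.add_apply, Pi.sub_apply, Pi.mul_apply]
  rw [hpow]
  have hk' : besselK (3 / 2 + γ) x = besselK (γ - 1 / 2) x + 2 * (1 / 2 + γ) / x * besselK (1 / 2 + γ) x := by
    field_simp at hk ⊢
    linarith
  generalize x ^ (3 / 2 - γ) = P
  generalize besselK (γ - 1 / 2) x = a at *
  generalize besselK (1 / 2 + γ) x = b at *
  generalize besselK (3 / 2 + γ) x = c at *
  rw [hk']
  field_simp
  ring

lemma b_sinh_le {x : ℝ} (hx : 0 ≤ x) : sinh x ≤ x * cosh x := by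
  have hm : MonotoneOn (fun x => x * cosh x - sinh x) (Ici 0) := by
    refine monotoneOn_of_deriv_nonneg (convex_Ici 0) (by fun_prop) (by fun_prop) fun y hy => ?_
    rw [interior_Ici] at hy
    have : HasDerivAt (fun x => x * cosh x - sinh x) (y * sinh y) y := by
      refine (((hasDerivAt_id y).mul (hasDerivAt_cosh y)).sub (hasDerivAt_sinh y)).congr_deriv ?_
      simp
    rw [this.deriv]
    exact mul_nonneg (le_of_lt hy) (sinh_nonneg_iff.mpr (le_of_lt hy))
  have := hm self_mem_Ici hx hx
  simp at this
  linarith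

lemma bPhi_bound {γ : ℝ} (hγ : γ ∈ Ioo (0 : ℝ) 1) (R : ℝ) (hR : 0 < R) :
    ∃ M : ℝ, ∀ x ∈ Ioc 0 R, |bPhi γ x| ≤ M * x ^ (1 - γ) := by
  obtain ⟨h0, h1⟩ := hγ
  obtain ⟨C2, c2, hC2⟩ := bk_bound (ν := 3 / 2 + γ) (p := 5 / 2) (by rw [abs_lt]; constructor <;> linarith)
  obtain ⟨C1, c1, hC1⟩ := bk_bound (ν := 1 / 2 + γ) (p := 3 / 2) (by rw [abs_lt]; constructor <;> linarith)
  obtain ⟨C0, c0, hC0⟩ := bk_bound (ν := γ - 1 / 2) (p := 1 / 2) (by rw [abs_lt]; constructor <;> linarith)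
  refine ⟨2 * (cosh R * C2 + cosh R * C1) + (cosh R * C1 + (R * (R * cosh R) + 3 * cosh R) * C0), fun x hx => ?_⟩
  obtain ⟨hx, hxR⟩ := hx
  have hch : cosh x ≤ cosh R := cosh_le_cosh.mpr (by rwa [abs_of_pos hx, abs_of_pos hR])
  have hcR := cosh_pos R
  have s0 : 0 ≤ sinh x := sinh_nonneg_iff.mpr hx.le
  have s1 : sinh x ≤ x * cosh R := (b_sinh_le hx.le).trans (by gcongr)
  have s2 : 0 ≤ cosh x - sinh x / x := by
    have := b_sinh_le hx.le
    rw [sub_nonneg, div_le_iff₀ hx]; linarith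
  have s3 : cosh x - sinh x / x ≤ cosh R := by
    have : 0 ≤ sinh x / x := by positivity
    linarith
  have s4 : |x * sinh x - 3 * (cosh x - sinh x / x)| ≤ R * (R * cosh R) + 3 * cosh R := by
    have : x * sinh x ≤ R * (R * cosh R) := by
      calc _ ≤ R * (x * cosh R) := by gcongr
        _ ≤ _ := by gcongr
    have : 0 ≤ x * sinh x := by positivity
    rw [abs_le]; constructor <;> nlinarith [mul_pos hR (mul_pos hR hcR)]
  have e0 : bPhi γ x = x ^ (5 / 2 - γ) * ((2 - γ) * (sinh x * besselK (3 / 2 + γ) x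
      + (cosh x - sinh x / x) * besselK (1 / 2 + γ) x)
    - ((cosh x - sinh x / x) * besselK (1 / 2 + γ) x
      + (x * sinh x - 3 * (cosh x - sinh x / x)) / x * besselK (γ - 1 / 2) x)) := by
    unfold bPhi
    congr 4
    field_simp
  have b2 : sinh x * besselK (3 / 2 + γ) x ≤ cosh R * C2 * x ^ (-(3 / 2) : ℝ) := by
    calc _ ≤ (x * cosh R) * (C2 * x ^ (-(5 / 2) : ℝ)) := by
          gcongr
          · exact bk_nonneg _ _
          · exact hC2 x hx
      _ = cosh R * C2 * (x ^ (-(5 / 2) : ℝ) * x) := by ring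
      _ = _ := by rw [← rpow_add_one hx.ne']; norm_num
  have b1 : (cosh x - sinh x / x) * besselK (1 / 2 + γ) x ≤ cosh R * C1 * x ^ (-(3 / 2) : ℝ) := by
    calc _ ≤ cosh R * (C1 * x ^ (-(3 / 2) : ℝ)) := by
          gcongr
          · exact bk_nonneg _ _
          · exact hC1 x hx
      _ = _ := by ring
  have b0 : |(x * sinh x - 3 * (cosh x - sinh x / x)) / x * besselK (γ - 1 / 2) x| ≤
      (R * (R * cosh R) + 3 * cosh R) * C0 * x ^ (-(3 / 2) : ℝ) := by
    rw [abs_mul, abs_div, abs_of_pos hx, abs_of_nonneg (bk_nonneg _ _)]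
    calc _ ≤ (R * (R * cosh R) + 3 * cosh R) / x * (C0 * x ^ (-(1 / 2) : ℝ)) := by
          gcongr
          · exact bk_nonneg _ _
          · exact hC0 x hx
      _ = (R * (R * cosh R) + 3 * cosh R) * C0 * (x ^ (-(1 / 2) : ℝ) / x) := by ring
      _ = _ := by rw [← rpow_sub_one hx.ne']; norm_num
  have p2 : 0 ≤ sinh x * besselK (3 / 2 + γ) x := mul_nonneg s0 (bk_nonneg _ _)
  have p1 : 0 ≤ (cosh x - sinh x / x) * besselK (1 / 2 + γ) x := mul_nonneg s2 (bk_nonneg _ _)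
  have hpow : x ^ (1 - γ) = x ^ (5 / 2 - γ) * x ^ (-(3 / 2) : ℝ) := by
    rw [← rpow_add hx]; ring_nf
  rw [e0, abs_mul, abs_of_pos (rpow_pos_of_pos hx _), hpow, mul_left_comm]
  refine mul_le_mul_of_nonneg_left ?_ (rpow_pos_of_pos hx _).le
  generalize sinh x * besselK (3 / 2 + γ) x = A at *
  generalize (cosh x - sinh x / x) * besselK (1 / 2 + γ) x = B at *
  generalize (x * sinh x - 3 * (cosh x - sinh x / x)) / x * besselK (γ - 1 / 2) x = D at *
  rw [abs_le] at b0 ⊢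
  have hAB : (2 - γ) * (A + B) ≤ 2 * (A + B) := by nlinarith
  have hAB' : 0 ≤ (2 - γ) * (A + B) := mul_nonneg (by linarith) (by linarith)
  constructor <;> linarith

lemma bPhi_integral {γ : ℝ} (hγ : γ ∈ Ioo (0 : ℝ) 1) (R : ℝ) (hR : 0 < R) :
    ∫ x in (0:ℝ)..R, 2 * (1 - γ) * (2 - γ) * (x ^ (3 / 2 - γ) * sinh x * besselK (3 / 2 + γ) x) =
      bPhi γ R := by
  have hz : bPhi γ 0 = 0 := by
    unfold bPhi
    rw [zero_rpow (by linarith [hγ.2]), zero_mul]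
  have hcont : ContinuousOn (bPhi γ) (Icc 0 R) := by
    intro x hx
    rcases hx.1.eq_or_lt with rfl | hx0
    · obtain ⟨M, hM⟩ := bPhi_bound hγ R hR
      rw [ContinuousWithinAt, hz]
      have ht : Tendsto (fun x : ℝ => M * x ^ (1 - γ)) (𝓝[Icc 0 R] 0) (𝓝 0) := by
        have h := (continuousAt_rpow_const (0:ℝ) (1 - γ) (Or.inr (by linarith [hγ.2]))).tendsto.const_mul M
        rw [zero_rpow (by linarith [hγ.2]), mul_zero] at h
        exact h.mono_left nhdsWithin_le_nhds
      refine squeeze_zero_norm' ?_ ht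
      filter_upwards [self_mem_nhdsWithin] with y hy
      rcases hy.1.eq_or_lt with rfl | hy0
      · rw [hz, zero_rpow (by linarith [hγ.2])]; simp
      · exact hM y ⟨hy0, hy.2⟩
    · exact (bPhi_deriv γ hx0).continuousAt.continuousWithinAt
  have hd : ∀ x ∈ Ioo 0 R, HasDerivAt (bPhi γ)
      (2 * (1 - γ) * (2 - γ) * (x ^ (3 / 2 - γ) * sinh x * besselK (3 / 2 + γ) x)) x :=
    fun x hx => bPhi_deriv γ hx.1
  have hi := intervalIntegral.integrableOn_deriv_of_nonneg hcont hd (fun x hx => by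
    have := bk_nonneg (3 / 2 + γ) x
    have h2 : 0 ≤ sinh x := sinh_nonneg_iff.mpr hx.1.le
    have h3 := rpow_nonneg hx.1.le (3 / 2 - γ)
    have h4 : 0 ≤ 1 - γ := by linarith [hγ.2]
    have h5 : 0 ≤ 2 - γ := by linarith [hγ.2]
    positivity)
  rw [intervalIntegral.integral_eq_sub_of_hasDerivAt_of_le hR.le hcont hd
    ((intervalIntegrable_iff_integrableOn_Ioc_of_le hR.le).mpr hi), hz, sub_zero]

lemma b_scale {γ : ℝ} (hγ : γ ∈ Ioo (0 : ℝ) 1) (R : ℝ) (hR : 0 < R) :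
    scaleI0 γ R = 2 ^ γ / ((1 - γ) * (2 - γ) * |Gamma (-γ)|) * (√2 / √π) * bPhi γ R := by
  have hG : 0 < Gamma (3 / 2 + γ) := Gamma_pos_of_pos (by linarith [hγ.1])
  have hG' : |Gamma (-γ)| ≠ 0 := by
    rw [abs_ne_zero]
    refine Gamma_ne_zero fun m hm => ?_
    rcases m with _ | m
    · simp at hm; linarith [hγ.1]
    · push_cast at hm
      have : (0:ℝ) ≤ m := by positivity
      linarith [hγ.2]
  have h1 : 1 - γ ≠ 0 := by linarith [hγ.2]
  have h2 : 2 - γ ≠ 0 := by linarith [hγ.2]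
  rw [scaleI0, ← bPhi_integral hγ R hR, ← intervalIntegral.integral_const_mul,
    ← intervalIntegral.integral_const_mul]
  refine intervalIntegral.integral_congr_ae (Eventually.of_forall fun x hx => ?_)
  rw [uIoc_of_le hR.le] at hx
  have hx0 := hx.1
  have hs : 0 < sinh x := sinh_pos_iff.mpr hx0
  have e1 : x ^ (3 / 2 - γ) = x ^ (-(1 / 2) - γ) * x ^ 2 := by
    rw [← rpow_natCast x 2, ← rpow_add hx0]; norm_num; ring_nf
  have e2 : (2:ℝ) ^ (2 * γ) = 2 ^ γ * 2 ^ γ := by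
    rw [← rpow_add (by norm_num)]; ring_nf
  have e3 : (2:ℝ) ^ (3 / 2 + γ) = 2 * √2 * 2 ^ γ := by
    rw [show (3:ℝ) / 2 + γ = 1 + 1 / 2 + γ by ring, rpow_add (by norm_num), rpow_add (by norm_num),
      ← sqrt_eq_rpow, rpow_one]
  have e4 : π ^ ((3:ℝ) / 2) = π * √π := by
    rw [show (3:ℝ) / 2 = 1 + 1 / 2 by ring, rpow_add pi_pos, ← sqrt_eq_rpow, rpow_one]
  have h3 : (√2:ℝ) ^ 2 = 2 := sq_sqrt (by norm_num)
  have h4 : (0:ℝ) < √π := sqrt_pos.mpr pi_pos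
  have h5 : (0:ℝ) < 2 ^ γ := by positivity
  rw [Kker, C3, e1, e2, e3, e4]
  generalize x ^ (-(1 / 2) - γ) = P
  generalize besselK (3 / 2 + γ) x = K
  generalize Gamma (3 / 2 + γ) = G at *
  have hG0 : G ≠ 0 := hG.ne'
  field_simp
  rw [h3]
  ring

end Helpers


/-- part of Lemma 5.1: explicit formula for `I_{0,γ}(R)` in terms of
modified Bessel functions. -/
theorem scaleI0_formula (γ : ℝ) (hγ : γ ∈ Set.Ioo (0 : ℝ) 1) (R : ℝ) (hR : 0 < R) :
    scaleI0 γ R =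
      (2 : ℝ) ^ γ * R ^ ((3 : ℝ) - γ) / ((1 - γ) * |Real.Gamma (-γ)|) *
          (besselI (1 / 2) R * besselK (3 / 2 + γ) R +
            besselI (3 / 2) R * besselK (1 / 2 + γ) R) -
        (2 : ℝ) ^ γ * R ^ ((3 : ℝ) - γ) / ((1 - γ) * (2 - γ) * |Real.Gamma (-γ)|) *
          (besselI (3 / 2) R * besselK (1 / 2 + γ) R +
            besselI (5 / 2) R * besselK (γ - 1 / 2) R) := by
  have e1 : besselI (1 / 2) R = √2 / √Real.pi * R ^ (-(1/2) : ℝ) * Real.sinh R := (bi_half hR).tsum_eq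
  have e3 : besselI (3 / 2) R = √2 / √Real.pi * R ^ (-(1/2) : ℝ) * (Real.cosh R - Real.sinh R / R) :=
    (bi_three hR).tsum_eq
  have e5 : besselI (5 / 2) R = √2 / √Real.pi * R ^ (-(1/2) : ℝ) *
      (Real.sinh R - 3 / R * (Real.cosh R - Real.sinh R / R)) := (bi_five hR).tsum_eq
  have h1 : 1 - γ ≠ 0 := by linarith [hγ.2]
  have h2 : 2 - γ ≠ 0 := by linarith [hγ.2]
  have hp : R ^ (5 / 2 - γ) = R ^ (3 - γ) * R ^ (-(1/2) : ℝ) := by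
    rw [← Real.rpow_add hR]; ring_nf
  have hsplit : (1 : ℝ) / ((1 - γ) * |Real.Gamma (-γ)|) =
      (2 - γ) * (1 / ((1 - γ) * (2 - γ) * |Real.Gamma (-γ)|)) := by
    field_simp
  rw [b_scale hγ R hR, e1, e3, e5, bPhi, hp]
  rw [div_eq_mul_one_div _ ((1 - γ) * |Real.Gamma (-γ)|), hsplit]
  ring
end

section
/- For each γ ∈ (0,1) and every R > 0, I_{∞,γ}(R) ≤ ((1−γ)/γ) · 𝓗(R) · I_{0,γ}(R), where 𝓗(R) = R · coth R. -/
open MeasureTheory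

open Filter Topology Set

namespace ScaleAux

lemma cube_le_sinh {x : ℝ} (hx : 0 ≤ x) : x + x ^ 3 / 6 ≤ Real.sinh x := by
  have hmono : MonotoneOn (fun x : ℝ => Real.sinh x - x - x ^ 3 / 6) (Ici 0) := by
    have hd : ∀ y : ℝ, HasDerivAt (fun x : ℝ => Real.sinh x - x - x ^ 3 / 6)
        (Real.cosh y - 1 - y ^ 2 / 2) y := by
      intro y
      have h := ((Real.hasDerivAt_sinh y).sub (hasDerivAt_id y)).sub
        ((hasDerivAt_pow 3 y).div_const 6)
      refine h.congr_deriv ?_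
      simp; ring
    apply monotoneOn_of_deriv_nonneg (convex_Ici 0)
    · exact fun y _ => (hd y).continuousAt.continuousWithinAt
    · exact fun y _ => (hd y).differentiableAt.differentiableWithinAt
    · intro y hy
      rw [(hd y).deriv]
      rw [interior_Ici] at hy
      have h1 : y / 2 ≤ Real.sinh (y / 2) := Real.self_le_sinh_iff.2 (by have := hy.out; linarith)
      have h2 : Real.cosh y = 1 + 2 * Real.sinh (y / 2) ^ 2 := by
        have := Real.cosh_two_mul (y / 2)
        rw [show 2 * (y / 2) = y by ring, Real.cosh_sq] at this
        linarith
      have h3 : 0 < y := hy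
      nlinarith
  have := hmono (mem_Ici.2 le_rfl) (mem_Ici.2 hx) hx
  simp at this
  linarith

lemma sinh_le_mul_cosh {x : ℝ} (hx : 0 ≤ x) : Real.sinh x ≤ x * Real.cosh x := by
  have hmono : MonotoneOn (fun x : ℝ => x * Real.cosh x - Real.sinh x) (Ici 0) := by
    have hd : ∀ y : ℝ, HasDerivAt (fun x : ℝ => x * Real.cosh x - Real.sinh x)
        (y * Real.sinh y) y := by
      intro y
      have h := ((hasDerivAt_id y).mul (Real.hasDerivAt_cosh y)).sub (Real.hasDerivAt_sinh y)
      refine h.congr_deriv ?_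
      simp
    apply monotoneOn_of_deriv_nonneg (convex_Ici 0)
    · exact fun y _ => (hd y).continuousAt.continuousWithinAt
    · exact fun y _ => (hd y).differentiableAt.differentiableWithinAt
    · intro y hy
      rw [(hd y).deriv]
      rw [interior_Ici] at hy
      exact mul_nonneg hy.out.le (Real.sinh_nonneg_iff.2 hy.out.le)
  have := hmono (mem_Ici.2 le_rfl) (mem_Ici.2 hx) hx
  simp at this
  linarith

lemma wilker {x : ℝ} (hx : 0 ≤ x) :
    2 * x ^ 2 * Real.cosh x ≤ Real.sinh x ^ 2 * Real.cosh x + x * Real.sinh x := by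
  have hmono : MonotoneOn (fun x : ℝ => Real.sinh x ^ 2 * Real.cosh x + x * Real.sinh x
      - 2 * x ^ 2 * Real.cosh x) (Ici 0) := by
    have hd : ∀ y : ℝ, HasDerivAt (fun x : ℝ => Real.sinh x ^ 2 * Real.cosh x + x * Real.sinh x
      - 2 * x ^ 2 * Real.cosh x)
        (3 * Real.sinh y * Real.cosh y ^ 2 - 3 * y * Real.cosh y - 2 * y ^ 2 * Real.sinh y) y := by
      intro y
      have h := ((((Real.hasDerivAt_sinh y).pow 2).mul (Real.hasDerivAt_cosh y)).add
        ((hasDerivAt_id y).mul (Real.hasDerivAt_sinh y))).sub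
        (((hasDerivAt_pow 2 y).const_mul 2).mul (Real.hasDerivAt_cosh y))
      refine h.congr_deriv ?_
      simp
      have := Real.cosh_sq y
      linear_combination (-Real.sinh y) * this
    apply monotoneOn_of_deriv_nonneg (convex_Ici 0)
    · exact fun y _ => (hd y).continuousAt.continuousWithinAt
    · exact fun y _ => (hd y).differentiableAt.differentiableWithinAt
    · intro y hy
      rw [(hd y).deriv]
      rw [interior_Ici] at hy
      have hy0 : 0 < y := hy
      have h1 := cube_le_sinh (x := 2 * y) (by linarith)
      rw [Real.sinh_two_mul] at h1
      have h2 := sinh_le_mul_cosh hy0.le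
      have h3 : 2 * y ^ 3 / 3 ≤ Real.sinh y * Real.cosh y - y := by nlinarith
      have h4 := mul_le_mul_of_nonneg_left h3 (Real.cosh_pos y).le
      have h5 := mul_le_mul_of_nonneg_left h2 (sq_nonneg y)
      nlinarith
  have := hmono (mem_Ici.2 le_rfl) (mem_Ici.2 hx) hx
  simp at this
  linarith

/-! ### integrand bounds -/

lemma cosh_le_exp_abs (y : ℝ) : Real.cosh y ≤ Real.exp |y| := by
  rw [← Real.cosh_abs, Real.cosh_eq]
  have : Real.exp (-|y|) ≤ Real.exp |y| := Real.exp_le_exp.2 (by have := abs_nonneg y; linarith)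
  linarith

lemma rpow_le_exp {p y : ℝ} (hp : 0 < p) (hy : 0 ≤ y) : (y / p) ^ p ≤ Real.exp y := by
  have h : y / p ≤ Real.exp (y / p) := by have := Real.add_one_le_exp (y / p); linarith
  have := Real.rpow_le_rpow (by positivity) h hp.le
  rwa [← Real.exp_mul, div_mul_cancel₀ _ hp.ne'] at this

lemma integrand_bound (μ : ℝ) {x p s : ℝ} (hx : 0 < x) (hp : 0 < p) (hs : 0 ≤ s) :
    Real.exp (-x * Real.cosh s) * Real.cosh (μ * s)
      ≤ (2 * p / x) ^ p * Real.exp ((|μ| - p) * s) := by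
  have h1 : Real.cosh (μ * s) ≤ Real.exp (|μ| * s) := by
    have := cosh_le_exp_abs (μ * s)
    rwa [abs_mul, abs_of_nonneg hs] at this
  have h2 : Real.exp s / 2 ≤ Real.cosh s := by
    rw [Real.cosh_eq]; have := Real.exp_pos (-s); linarith
  have h3 : Real.exp (-x * Real.cosh s) ≤ Real.exp (-(x * Real.exp s / 2)) := by
    apply Real.exp_le_exp.2; nlinarith
  have h4 := rpow_le_exp hp (y := x * Real.exp s / 2) (by positivity)
  have h5 : (x * Real.exp s / 2 / p) ^ p = ((2 * p / x) ^ p)⁻¹ * Real.exp (p * s) := by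
    rw [show x * Real.exp s / 2 / p = (2 * p / x)⁻¹ * Real.exp s by field_simp,
      Real.mul_rpow (by positivity) (by positivity), Real.inv_rpow (by positivity),
      ← Real.exp_mul, mul_comm s p]
  rw [h5] at h4
  have h6 : 0 < (2 * p / x) ^ p := by positivity
  have h7 : Real.exp (-(x * Real.exp s / 2)) ≤ (2 * p / x) ^ p * Real.exp (-(p * s)) := by
    rw [Real.exp_neg, Real.exp_neg]
    calc (Real.exp (x * Real.exp s / 2))⁻¹ ≤ (((2 * p / x) ^ p)⁻¹ * Real.exp (p * s))⁻¹ :=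
          inv_anti₀ (by positivity) h4
      _ = _ := by rw [mul_inv, inv_inv]
  calc _ ≤ ((2 * p / x) ^ p * Real.exp (-(p * s))) * Real.exp (|μ| * s) :=
        mul_le_mul (h3.trans h7) h1 (Real.cosh_pos _).le (by positivity)
    _ = _ := by rw [mul_assoc, ← Real.exp_add]; ring_nf

lemma integrand_integrable (μ : ℝ) {x : ℝ} (hx : 0 < x) :
    IntegrableOn (fun s => Real.exp (-x * Real.cosh s) * Real.cosh (μ * s)) (Ioi 0) := by
  have hp : 0 < |μ| + 1 := by positivity
  have hi := (integrableOn_exp_mul_Ioi (a := |μ| - (|μ| + 1)) (by linarith) 0).const_mul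
    ((2 * (|μ| + 1) / x) ^ (|μ| + 1))
  refine Integrable.mono' hi ?_ ?_
  · exact (by fun_prop : Continuous fun s : ℝ =>
      Real.exp (-x * Real.cosh s) * Real.cosh (μ * s)).aestronglyMeasurable
  · refine (ae_restrict_iff' measurableSet_Ioi).2 (ae_of_all _ fun s hs => ?_)
    rw [Real.norm_of_nonneg (mul_nonneg (Real.exp_pos _).le (Real.cosh_pos _).le)]
    exact integrand_bound μ hx hp hs.out.le

lemma integrand_tendsto (μ : ℝ) {x : ℝ} (hx : 0 < x) :
    Tendsto (fun s => Real.exp (-x * Real.cosh s) * Real.cosh (μ * s)) atTop (𝓝 0) := by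
  have hp : 0 < |μ| + 1 := by positivity
  have h1 : Tendsto (fun s : ℝ => (2 * (|μ| + 1) / x) ^ (|μ| + 1) *
      Real.exp ((|μ| - (|μ| + 1)) * s)) atTop (𝓝 0) := by
    have : Tendsto (fun s : ℝ => Real.exp ((|μ| - (|μ| + 1)) * s)) atTop (𝓝 0) := by
      refine Real.tendsto_exp_neg_atTop_nhds_zero.congr fun s => ?_
      congr 1; ring
    simpa using this.const_mul ((2 * (|μ| + 1) / x) ^ (|μ| + 1))
  refine squeeze_zero' (Eventually.of_forall fun s => ?_) ?_ h1
  · exact mul_nonneg (Real.exp_pos _).le (Real.cosh_pos _).le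
  · filter_upwards [eventually_ge_atTop 0] with s hs
    exact integrand_bound μ hx hp hs

lemma besselK_nonneg (μ x : ℝ) : 0 ≤ besselK μ x :=
  integral_nonneg fun _ => mul_nonneg (Real.exp_pos _).le (Real.cosh_pos _).le

lemma besselK_le_rpow {μ x p : ℝ} (hx : 0 < x) (hp : |μ| < p) :
    besselK μ x ≤ ((2 * p) ^ p / (p - |μ|)) * x ^ (-p) := by
  have hp0 : 0 < p := (abs_nonneg μ).trans_lt hp
  have hi := (integrableOn_exp_mul_Ioi (a := |μ| - p) (by linarith) 0).const_mul
    ((2 * p / x) ^ p)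
  have h := setIntegral_mono_on (integrand_integrable μ hx) hi measurableSet_Ioi
    (fun s hs => integrand_bound μ hx hp0 (le_of_lt hs))
  refine h.trans (le_of_eq ?_)
  rw [integral_const_mul, integral_exp_mul_Ioi (by linarith), Real.div_rpow (by positivity) hx.le,
    Real.rpow_neg hx.le]
  have : p - |μ| ≠ 0 := by linarith
  have : |μ| - p ≠ 0 := by linarith
  simp
  field_simp
  ring

/-- Lower bound for an integral over `(0,∞)` from a sub-primitive. -/
lemma integral_nonneg_of_subprimitive {Ψ G G' : ℝ → ℝ} (hΨ : IntegrableOn Ψ (Ioi 0))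
    (hc : Continuous Ψ) (hG : ∀ s, HasDerivAt G (G' s) s) (hle : ∀ s, 0 ≤ s → G' s ≤ Ψ s)
    (h0 : G 0 = 0) (ht : Tendsto G atTop (𝓝 0)) : 0 ≤ ∫ s in Ioi 0, Ψ s := by
  have h1 := intervalIntegral_tendsto_integral_Ioi 0 hΨ tendsto_id
  refine le_of_tendsto_of_tendsto ht h1 ?_
  filter_upwards [eventually_ge_atTop 0] with b hb
  have := intervalIntegral.sub_le_integral_of_hasDeriv_right_of_le hb
    (fun s _ => (hG s).continuousAt.continuousWithinAt)
    (fun s _ => (hG s).hasDerivWithinAt) hc.continuousOn.integrableOn_Icc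
    (fun s hs => hle s hs.1.le)
  rw [h0] at this
  simpa using this

lemma cosh_prod (μ s : ℝ) : Real.sinh s * Real.sinh (μ * s) =
    (Real.cosh ((μ + 1) * s) - Real.cosh ((μ - 1) * s)) / 2 := by
  rw [add_mul, sub_mul, one_mul, Real.cosh_add, Real.cosh_sub]; ring

lemma cosh_prod' (μ s : ℝ) : Real.cosh s * Real.cosh (μ * s) =
    (Real.cosh ((μ + 1) * s) + Real.cosh ((μ - 1) * s)) / 2 := by
  rw [add_mul, sub_mul, one_mul, Real.cosh_add, Real.cosh_sub]; ring

lemma abs_sinh_le (y : ℝ) : |Real.sinh y| ≤ Real.cosh y := by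
  rw [abs_le]
  have h1 := Real.cosh_sub_sinh y
  have h2 := Real.cosh_add_sinh y
  have := Real.exp_pos y
  have := Real.exp_pos (-y)
  constructor <;> linarith

lemma hasDerivAt_expcosh (x s : ℝ) : HasDerivAt (fun s => Real.exp (-x * Real.cosh s))
    (-x * Real.sinh s * Real.exp (-x * Real.cosh s)) s := by
  have := ((Real.hasDerivAt_cosh s).const_mul (-x)).exp
  refine this.congr_deriv ?_; ring

lemma hasDerivAt_sinh_mul (μ s : ℝ) : HasDerivAt (fun s => Real.sinh (μ * s))
    (μ * Real.cosh (μ * s)) s := by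
  have := ((hasDerivAt_id s).const_mul μ).sinh
  refine this.congr_deriv ?_; simp only [id]; ring

lemma besselK_rec (μ : ℝ) {x : ℝ} (hx : 0 < x) :
    x * (besselK (μ + 1) x - besselK (μ - 1) x) = 2 * μ * besselK μ x := by
  have i0 := integrand_integrable μ hx
  have ip := integrand_integrable (μ + 1) hx
  have im := integrand_integrable (μ - 1) hx
  have ht : Tendsto (fun s => Real.exp (-x * Real.cosh s) * Real.sinh (μ * s)) atTop (𝓝 0) := by
    refine squeeze_zero_norm (fun s => ?_) (integrand_tendsto μ hx)
    rw [norm_mul, Real.norm_of_nonneg (Real.exp_pos _).le]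
    exact mul_le_mul_of_nonneg_left (abs_sinh_le _) (Real.exp_pos _).le
  have key := integral_Ioi_of_hasDerivAt_of_tendsto' (a := 0)
    (f := fun s => Real.exp (-x * Real.cosh s) * Real.sinh (μ * s))
    (f' := fun s => μ * (Real.exp (-x * Real.cosh s) * Real.cosh (μ * s)) -
      x / 2 * ((Real.exp (-x * Real.cosh s) * Real.cosh ((μ + 1) * s)) -
        (Real.exp (-x * Real.cosh s) * Real.cosh ((μ - 1) * s)))) (m := 0) ?_ ?_ ht
  · have e := integral_sub ip im
    have e2 := integral_sub (i0.const_mul μ) ((ip.sub im).const_mul (x / 2))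
    simp only [Pi.sub_apply] at e e2
    rw [e2, integral_const_mul, integral_const_mul, e] at key
    simp at key
    simp only [besselK]
    simp only [neg_mul]
    linarith
  · intro s _
    refine ((hasDerivAt_expcosh x s).mul (hasDerivAt_sinh_mul μ s)).congr_deriv ?_
    have := cosh_prod μ s
    linear_combination (-x * Real.exp (-x * Real.cosh s)) * this
  · exact (i0.const_mul μ).sub ((ip.sub im).const_mul _)

lemma besselK_hasDerivAt (μ : ℝ) {x : ℝ} (hx : 0 < x) :
    HasDerivAt (besselK μ) (-(besselK (μ + 1) x + besselK (μ - 1) x) / 2) x := by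
  have hx2 : 0 < x / 2 := by linarith
  have ip := integrand_integrable (μ + 1) hx
  have im := integrand_integrable (μ - 1) hx
  have ip2 := integrand_integrable (μ + 1) hx2
  have im2 := integrand_integrable (μ - 1) hx2
  have key := (hasDerivAt_integral_of_dominated_loc_of_deriv_le (μ := volume.restrict (Ioi (0:ℝ)))
    (F := fun y s => Real.exp (-y * Real.cosh s) * Real.cosh (μ * s))
    (F' := fun y s => -((Real.exp (-y * Real.cosh s) * Real.cosh ((μ + 1) * s)) +
        (Real.exp (-y * Real.cosh s) * Real.cosh ((μ - 1) * s))) / 2)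
    (bound := fun s => ((Real.exp (-(x/2) * Real.cosh s) * Real.cosh ((μ + 1) * s)) +
        (Real.exp (-(x/2) * Real.cosh s) * Real.cosh ((μ - 1) * s))) / 2)
    (s := Ioi (x/2)) (x₀ := x) (Ioi_mem_nhds (by linarith)) ?_ (integrand_integrable μ hx) ?_ ?_
    ((ip2.add im2).div_const 2) ?_).2
  · refine key.congr_deriv ?_
    rw [integral_div, integral_neg, integral_add ip im]
    rfl
  · exact Eventually.of_forall fun y => (by fun_prop : Continuous fun s : ℝ =>
      Real.exp (-y * Real.cosh s) * Real.cosh (μ * s)).aestronglyMeasurable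
  · exact (by fun_prop : Continuous fun s : ℝ => 
      -((Real.exp (-x * Real.cosh s) * Real.cosh ((μ + 1) * s)) +
        (Real.exp (-x * Real.cosh s) * Real.cosh ((μ - 1) * s))) / 2).aestronglyMeasurable
  · refine ae_of_all _ fun s y hy => ?_
    have hp := Real.cosh_pos ((μ + 1) * s)
    have hm := Real.cosh_pos ((μ - 1) * s)
    have he : Real.exp (-y * Real.cosh s) ≤ Real.exp (-(x/2) * Real.cosh s) := by
      apply Real.exp_le_exp.2
      have := Real.cosh_pos s
      have := hy.out
      nlinarith
    rw [neg_div, norm_neg, Real.norm_of_nonneg (by positivity)]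
    gcongr
  · refine ae_of_all _ fun s y hy => ?_
    have h := (((hasDerivAt_id y).neg.mul_const (Real.cosh s)).exp).mul_const (Real.cosh (μ * s))
    refine h.congr_deriv ?_
    have := cosh_prod' μ s
    try simp only [Pi.neg_apply, id]
    linear_combination (-Real.exp (-y * Real.cosh s)) * this

lemma phi_deriv_le {a s : ℝ} (ha : 1 ≤ a) (hs : 0 ≤ s) :
    Real.cosh ((a - 1 / 2) * s) ≤
      (a * Real.cosh (a * s) * Real.cosh (1 / 2 * s) -
        Real.sinh (a * s) * (1 / 2 * Real.sinh (1 / 2 * s))) / Real.cosh (1 / 2 * s) ^ 2 := by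
  have h1 : 0 ≤ Real.sinh ((a - 1) * s) :=
    Real.sinh_nonneg_iff.2 (mul_nonneg (by linarith) hs)
  have hσ : 0 ≤ Real.sinh (1 / 2 * s) := Real.sinh_nonneg_iff.2 (by positivity)
  rw [sub_mul, one_mul, Real.sinh_sub] at h1
  have h2 : Real.cosh s = 2 * Real.cosh (1 / 2 * s) ^ 2 - 1 := by
    have := Real.cosh_two_mul (1 / 2 * s)
    rw [show 2 * (1 / 2 * s) = s by ring, Real.sinh_sq] at this
    linarith
  have h3 : Real.sinh s = 2 * Real.sinh (1 / 2 * s) * Real.cosh (1 / 2 * s) := by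
    have := Real.sinh_two_mul (1 / 2 * s)
    rwa [show 2 * (1 / 2 * s) = s by ring] at this
  rw [h2, h3] at h1
  have hc := Real.cosh_pos (1 / 2 * s)
  rw [le_div_iff₀ (by positivity), sub_mul, Real.cosh_sub]
  have h4 := mul_nonneg h1 hσ
  have h5 : 0 ≤ Real.cosh (a * s) * Real.cosh (1 / 2 * s) * (a - 1) :=
    mul_nonneg (mul_nonneg (Real.cosh_pos _).le hc.le) (by linarith)
  have h6 := Real.sinh_sq (1 / 2 * s)
  generalize Real.cosh (1 / 2 * s) = c at *
  generalize Real.sinh (1 / 2 * s) = σ at *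
  generalize Real.cosh (a * s) = C at *
  generalize Real.sinh (a * s) = S at *
  have h7 : C * σ * c * σ = C * c * (c ^ 2 - 1) := by rw [← h6]; ring
  nlinarith

lemma besselK_ratio {a x : ℝ} (ha : 1 ≤ a) (hx : 0 < x) :
    (x + 1) * besselK (a - 1 / 2) x ≤ x * besselK (a + 1 / 2) x := by
  have ip := integrand_integrable (a + 1 / 2) hx
  have im := integrand_integrable (a - 1 / 2) hx
  have hΨ := (ip.const_mul x).sub (im.const_mul (x + 1))
  have key := integral_nonneg_of_subprimitive hΨ
    (G := fun s => -(Real.exp (-x * Real.cosh s) * (Real.sinh (a * s) / Real.cosh (1 / 2 * s))))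
    (G' := fun s => -((-x * Real.sinh s * Real.exp (-x * Real.cosh s)) *
        (Real.sinh (a * s) / Real.cosh (1 / 2 * s)) + Real.exp (-x * Real.cosh s) *
        ((a * Real.cosh (a * s) * Real.cosh (1 / 2 * s) -
        Real.sinh (a * s) * (1 / 2 * Real.sinh (1 / 2 * s))) / Real.cosh (1 / 2 * s) ^ 2)))
    ?_ ?_ ?_ ?_ ?_
  · have e := integral_sub (ip.const_mul x) (im.const_mul (x + 1))
    simp only [Pi.sub_apply] at key e
    rw [e, integral_const_mul, integral_const_mul] at key
    simp only [besselK]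
    linarith
  · show Continuous fun s : ℝ => _
    simp only [Pi.sub_apply]
    fun_prop
  · intro s
    have hc : HasDerivAt (fun s => Real.cosh (1 / 2 * s))
        (1 / 2 * Real.sinh (1 / 2 * s)) s := by
      have := ((hasDerivAt_id s).const_mul (1 / 2 : ℝ)).cosh
      refine this.congr_deriv ?_; simp only [id]; ring
    exact ((hasDerivAt_expcosh x s).mul
      ((hasDerivAt_sinh_mul a s).div hc (Real.cosh_pos _).ne')).neg
  · intro s hs
    have h1 := mul_le_mul_of_nonneg_left (phi_deriv_le ha hs) (Real.exp_pos (-x * Real.cosh s)).le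
    have h3 : Real.sinh s = 2 * Real.sinh (1 / 2 * s) * Real.cosh (1 / 2 * s) := by
      have := Real.sinh_two_mul (1 / 2 * s)
      rwa [show 2 * (1 / 2 * s) = s by ring] at this
    have h4 : Real.sinh s * (Real.sinh (a * s) / Real.cosh (1 / 2 * s)) =
        Real.cosh ((a + 1 / 2) * s) - Real.cosh ((a - 1 / 2) * s) := by
      rw [add_mul, sub_mul, Real.cosh_add, Real.cosh_sub, h3]
      have hc := (Real.cosh_pos (1 / 2 * s)).ne'
      field_simp
      ring
    simp only [Pi.sub_apply]
    linear_combination h1 + x * Real.exp (-x * Real.cosh s) * h4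
  · simp
  · rw [← neg_zero]
    refine Tendsto.neg ?_
    refine squeeze_zero_norm (fun s => ?_) (integrand_tendsto a hx)
    rw [norm_mul, Real.norm_of_nonneg (Real.exp_pos _).le]
    refine mul_le_mul_of_nonneg_left ?_ (Real.exp_pos _).le
    rw [norm_div, Real.norm_of_nonneg (Real.cosh_pos _).le]
    exact (div_le_self (norm_nonneg _) (Real.one_le_cosh _)).trans (abs_sinh_le _)

lemma besselK_tanh {a x : ℝ} (ha : 1 ≤ a) (hx : 0 < x) :
    Real.cosh x * besselK (a - 1 / 2) x ≤ Real.sinh x * besselK (a + 1 / 2) x := by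
  have h := besselK_ratio ha hx
  have h2 : x * Real.cosh x ≤ (x + 1) * Real.sinh x := by
    -- x e^{-x} ≤ sinh x
    have h3 := Real.self_le_sinh_iff.2 hx.le
    have h4 := Real.cosh_sub_sinh x
    have h5 : Real.exp (-x) ≤ 1 := Real.exp_le_one_iff.2 (by linarith)
    nlinarith
  have h0 := besselK_nonneg (a + 1 / 2) x
  have h6 : (x + 1) * (Real.cosh x * besselK (a - 1 / 2) x) ≤
      (x + 1) * (Real.sinh x * besselK (a + 1 / 2) x) := by
    have h7 := mul_le_mul_of_nonneg_left h (Real.cosh_pos x).le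
    have h8 := mul_le_mul_of_nonneg_right h2 h0
    linarith
  exact le_of_mul_le_mul_left h6 (by linarith)

/-- Decay at infinity. -/
lemma besselK_decay (μ : ℝ) : ∃ M : ℝ, 0 ≤ M ∧ ∀ x, 2 ≤ x →
    Real.exp x * besselK μ x ≤ M * x ^ (-(1 / 2 : ℝ)) := by
  set p := |μ| + 1 with hpdef
  have hp : 0 < p := by positivity
  set M := Real.exp 1 * (2 * p / 1) ^ p with hM
  have hM0 : 0 ≤ M := by positivity
  refine ⟨M * (√(Real.pi * 4) / 2), by positivity, fun x hx => ?_⟩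
  have hx0 : 0 < x := by linarith
  have hb : ∀ s ∈ Ioi (0:ℝ), Real.exp x * (Real.exp (-x * Real.cosh s) * Real.cosh (μ * s)) ≤
      M * Real.exp (-(x / 4) * s ^ 2) := by
    intro s hs
    have h1 := integrand_bound μ one_pos hp (le_of_lt hs)
    have h2 : Real.exp ((|μ| - p) * s) ≤ 1 := by
      apply Real.exp_le_one_iff.2
      have := hs.out
      rw [hpdef]; linarith
    have h3 : Real.exp (-1 * Real.cosh s) * Real.cosh (μ * s) ≤ (2 * p / 1) ^ p := by
      refine h1.trans ?_
      exact mul_le_of_le_one_right (by positivity) h2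
    have h4 : 1 + s ^ 2 / 2 ≤ Real.cosh s := by
      have h5 : s / 2 ≤ Real.sinh (s / 2) := Real.self_le_sinh_iff.2 (by have := hs.out; linarith)
      have h6 : Real.cosh s = 1 + 2 * Real.sinh (s / 2) ^ 2 := by
        have := Real.cosh_two_mul (s / 2)
        rw [show 2 * (s / 2) = s by ring, Real.cosh_sq] at this
        linarith
      have h7 : 0 < s := hs
      nlinarith
    have h8 : Real.exp (x - 1 - (x - 1) * Real.cosh s) ≤ Real.exp (-(x / 4) * s ^ 2) := by
      apply Real.exp_le_exp.2
      have := sq_nonneg s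
      nlinarith [mul_le_mul_of_nonneg_left h4 (by linarith : 0 ≤ x - 1),
        mul_nonneg (by linarith : 0 ≤ x - 2) this]
    have h9 : Real.exp x * (Real.exp (-x * Real.cosh s) * Real.cosh (μ * s)) =
        (Real.exp 1 * (Real.exp (-1 * Real.cosh s) * Real.cosh (μ * s))) *
        Real.exp (x - 1 - (x - 1) * Real.cosh s) := by
      have : Real.exp x * Real.exp (-x * Real.cosh s) = Real.exp 1 * Real.exp (-1 * Real.cosh s) *
        Real.exp (x - 1 - (x - 1) * Real.cosh s) := by
        rw [← Real.exp_add, ← Real.exp_add, ← Real.exp_add]; ring_nf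
      linear_combination Real.cosh (μ * s) * this
    rw [h9, hM]
    gcongr
  have hi : IntegrableOn (fun s : ℝ => M * Real.exp (-(x / 4) * s ^ 2)) (Ioi 0) :=
    ((integrable_exp_neg_mul_sq (by linarith : 0 < x / 4)).integrableOn).const_mul M
  have h := setIntegral_mono_on ((integrand_integrable μ hx0).const_mul (Real.exp x)) hi
    measurableSet_Ioi hb
  rw [integral_const_mul, integral_const_mul, integral_gaussian_Ioi] at h
  refine h.trans (le_of_eq ?_)
  rw [show Real.pi / (x / 4) = (Real.pi * 4) / x by field_simp, Real.sqrt_div (by positivity),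
    Real.rpow_neg hx0.le, ← Real.sqrt_eq_rpow]
  field_simp

/-- `h(t) = t^{-1/2-γ} K_{3/2+γ}(t)`. -/
noncomputable def hh (γ t : ℝ) : ℝ := t ^ (-(1 / 2 : ℝ) - γ) * besselK (3 / 2 + γ) t

/-- `k(t) = t^{-1/2-γ} K_{1/2+γ}(t)`. -/
noncomputable def kk (γ t : ℝ) : ℝ := t ^ (-(1 / 2 : ℝ) - γ) * besselK (1 / 2 + γ) t

/-- The explicit tail integral. -/
noncomputable def XX (γ t : ℝ) : ℝ :=
  (1 / (2 * γ)) * (t * Real.sinh t * hh γ t + (t * Real.cosh t - Real.sinh t) * kk γ t)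

lemma hh_nonneg (γ : ℝ) {t : ℝ} (ht : 0 ≤ t) : 0 ≤ hh γ t :=
  mul_nonneg (Real.rpow_nonneg ht _) (besselK_nonneg _ _)

lemma kk_nonneg (γ : ℝ) {t : ℝ} (ht : 0 ≤ t) : 0 ≤ kk γ t :=
  mul_nonneg (Real.rpow_nonneg ht _) (besselK_nonneg _ _)

lemma kk_le {γ t : ℝ} (hγ : 0 < γ) (ht : 0 < t) :
    Real.cosh t * kk γ t ≤ Real.sinh t * hh γ t := by
  have h := besselK_tanh (a := 1 + γ) (by linarith) ht
  rw [show 1 + γ - 1 / 2 = 1 / 2 + γ by ring, show 1 + γ + 1 / 2 = 3 / 2 + γ by ring] at h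
  have := mul_le_mul_of_nonneg_left h (Real.rpow_nonneg ht.le (-(1 / 2 : ℝ) - γ))
  simp only [hh, kk]
  linarith

lemma kk_hasDerivAt (γ : ℝ) {t : ℝ} (ht : 0 < t) : HasDerivAt (kk γ) (-hh γ t) t := by
  have h1 := besselK_hasDerivAt (1 / 2 + γ) ht
  have h2 := besselK_rec (1 / 2 + γ) ht
  rw [show 1 / 2 + γ + 1 = 3 / 2 + γ by ring] at h1 h2
  have h3 := (Real.hasDerivAt_rpow_const (p := -(1 / 2 : ℝ) - γ) (Or.inl ht.ne')).mul h1
  refine h3.congr_deriv ?_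
  rw [Real.rpow_sub_one ht.ne', hh]
  have h4 : besselK (1 / 2 + γ - 1) t =
      besselK (3 / 2 + γ) t - (1 + 2 * γ) * besselK (1 / 2 + γ) t / t := by
    have := eq_div_of_mul_eq ht.ne' ((mul_comm _ _).trans h2)
    linear_combination -this
  rw [h4]
  field_simp
  ring

lemma hh_hasDerivAt (γ : ℝ) {t : ℝ} (ht : 0 < t) :
    HasDerivAt (hh γ) (-kk γ t - (2 + 2 * γ) / t * hh γ t) t := by
  have h1 := besselK_hasDerivAt (3 / 2 + γ) ht
  have h2 := besselK_rec (3 / 2 + γ) ht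
  rw [show 3 / 2 + γ - 1 = 1 / 2 + γ by ring] at h1 h2
  have h3 := (Real.hasDerivAt_rpow_const (p := -(1 / 2 : ℝ) - γ) (Or.inl ht.ne')).mul h1
  refine h3.congr_deriv ?_
  rw [Real.rpow_sub_one ht.ne', hh, kk]
  have h4 : besselK (3 / 2 + γ + 1) t =
      besselK (1 / 2 + γ) t + (3 + 2 * γ) * besselK (3 / 2 + γ) t / t := by
    have := eq_div_of_mul_eq ht.ne' ((mul_comm _ _).trans h2)
    linear_combination this
  rw [h4]
  field_simp
  ring

lemma XX_hasDerivAt {γ t : ℝ} (hγ : 0 < γ) (ht : 0 < t) :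
    HasDerivAt (XX γ) (-(Real.sinh t * hh γ t)) t := by
  have hs := Real.hasDerivAt_sinh t
  have hc := Real.hasDerivAt_cosh t
  have hi := hasDerivAt_id t
  have h := ((((hi.mul hs).mul (hh_hasDerivAt γ ht)).add
    (((hi.mul hc).sub hs).mul (kk_hasDerivAt γ ht))).const_mul (1 / (2 * γ)))
  refine h.congr_deriv ?_
  simp only [Pi.mul_apply, Pi.sub_apply, id]
  field_simp
  ring

lemma XX_nonneg {γ t : ℝ} (hγ : 0 < γ) (ht : 0 ≤ t) : 0 ≤ XX γ t := by
  have h1 := sinh_le_mul_cosh ht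
  have h2 := hh_nonneg γ ht
  have h3 := kk_nonneg γ ht
  have h4 := Real.sinh_nonneg_iff.2 ht
  have h5 : 0 ≤ t * Real.cosh t - Real.sinh t := by linarith
  unfold XX
  positivity

lemma XX_le {γ t : ℝ} (hγ : 0 < γ) (ht : 0 < t) :
    XX γ t ≤ (1 / γ) * (t * Real.sinh t * hh γ t) := by
  have h2 := hh_nonneg γ ht.le
  have h3 := kk_nonneg γ ht.le
  have h4 := Real.sinh_nonneg_iff.2 ht.le
  have h5 := kk_le hγ ht
  have h6 : XX γ t ≤ (1 / (2 * γ)) * (2 * (t * Real.sinh t * hh γ t)) := by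
    unfold XX
    refine mul_le_mul_of_nonneg_left ?_ (by positivity)
    have := mul_le_mul_of_nonneg_left h5 ht.le
    have := mul_nonneg h4 h3
    nlinarith
  refine h6.trans (le_of_eq ?_)
  field_simp

lemma XX_tendsto {γ : ℝ} (hγ : 0 < γ) : Tendsto (XX γ) atTop (𝓝 0) := by
  obtain ⟨M, hM, hb⟩ := besselK_decay (3 / 2 + γ)
  have h1 : Tendsto (fun t : ℝ => (1 / γ * M) * t ^ (-γ)) atTop (𝓝 0) := by
    simpa using (tendsto_rpow_neg_atTop hγ).const_mul (1 / γ * M)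
  refine squeeze_zero' ?_ ?_ h1
  · filter_upwards [eventually_ge_atTop 0] with t ht using XX_nonneg hγ ht
  · filter_upwards [eventually_ge_atTop 2] with t ht
    have ht0 : 0 < t := by linarith
    refine (XX_le hγ ht0).trans ?_
    have h2 : Real.sinh t ≤ Real.exp t := by
      have := Real.cosh_add_sinh t; have := Real.cosh_pos t; linarith
    have h3 := hb t ht
    have h4 := besselK_nonneg (3 / 2 + γ) t
    have h5 : t ^ (-γ) = t * t ^ (-(1 / 2 : ℝ) - γ) * t ^ (-(1 / 2 : ℝ)) := by
      nth_rewrite 2 [← Real.rpow_one t]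
      rw [← Real.rpow_add ht0, ← Real.rpow_add ht0]
      congr 1; ring
    rw [h5, mul_assoc (1 / γ)]
    refine mul_le_mul_of_nonneg_left ?_ (by positivity)
    unfold hh
    calc t * Real.sinh t * (t ^ (-(1 / 2 : ℝ) - γ) * besselK (3 / 2 + γ) t)
        = t * t ^ (-(1 / 2 : ℝ) - γ) * (Real.sinh t * besselK (3 / 2 + γ) t) := by ring
      _ ≤ t * t ^ (-(1 / 2 : ℝ) - γ) * (M * t ^ (-(1 / 2 : ℝ))) := by
          refine mul_le_mul_of_nonneg_left ?_ (by positivity)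
          exact (mul_le_mul_of_nonneg_right h2 h4).trans h3
      _ = _ := by ring

lemma tail_eq {γ R : ℝ} (hγ : 0 < γ) (hR : 0 < R) :
    ∫ t in Ioi R, Real.sinh t * hh γ t = XX γ R := by
  have h := integral_Ioi_of_hasDerivAt_of_nonpos' (a := R) (g := XX γ)
    (g' := fun t => -(Real.sinh t * hh γ t)) (l := 0)
    (fun t ht => XX_hasDerivAt hγ (hR.trans_le ht))
    (fun t ht => by
      have h0 : 0 ≤ t := (hR.trans ht.out).le
      have := mul_nonneg (Real.sinh_nonneg_iff.2 h0) (hh_nonneg γ h0)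
      linarith) (XX_tendsto hγ)
  rw [integral_neg] at h
  linarith

/-- Small-argument bound. -/
lemma hh_small {γ : ℝ} (hγ : 0 < γ) (hγ1 : γ < 1) : ∃ M : ℝ, 0 ≤ M ∧ ∀ t, 0 < t →
    t ^ 3 * hh γ t ≤ M * t ^ (-γ) := by
  have hab : |3 / 2 + γ| = 3 / 2 + γ := abs_of_pos (by linarith)
  have hab' : |3 / 2 + γ| < 5 / 2 := by rw [hab]; linarith
  refine ⟨(2 * (5 / 2)) ^ (5 / 2 : ℝ) / (5 / 2 - |3 / 2 + γ|), ?_, fun t ht => ?_⟩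
  · exact div_nonneg (by positivity) (by linarith)
  · have h := besselK_le_rpow ht hab'
    have e : t ^ (-γ) = t ^ 3 * t ^ (-(1 / 2 : ℝ) - γ) * t ^ (-(5 / 2 : ℝ)) := by
      rw [← Real.rpow_natCast, ← Real.rpow_add ht, ← Real.rpow_add ht]
      congr 1; push_cast; ring
    rw [e]
    unfold hh
    have := mul_le_mul_of_nonneg_left h
      (by positivity : 0 ≤ t ^ 3 * t ^ (-(1 / 2 : ℝ) - γ))
    linarith

lemma hh_continuousOn (γ : ℝ) : ContinuousOn (hh γ) (Ioi 0) :=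
  fun _ ht => (hh_hasDerivAt γ ht).continuousAt.continuousWithinAt

lemma near_integrable {γ R : ℝ} (hγ : 0 < γ) (hγ1 : γ < 1) (hR : 0 < R) :
    IntegrableOn (fun t => t ^ 2 * (Real.sinh t * hh γ t)) (Icc 0 R) := by
  obtain ⟨M, hM, hb⟩ := hh_small hγ hγ1
  rw [integrableOn_Icc_iff_integrableOn_Ioc]
  have hi : IntegrableOn (fun t : ℝ => (Real.cosh R * M) * t ^ (-γ)) (Ioc 0 R) := by
    have := (intervalIntegral.intervalIntegrable_rpow' (a := 0) (b := R) (r := -γ)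
      (by linarith)).const_mul (Real.cosh R * M)
    exact (intervalIntegrable_iff_integrableOn_Ioc_of_le hR.le).1 this
  refine Integrable.mono' hi ?_ ?_
  · refine ContinuousOn.aestronglyMeasurable ?_ measurableSet_Ioc
    exact (continuous_pow 2).continuousOn.mul (Real.continuous_sinh.continuousOn.mul
      ((hh_continuousOn γ).mono fun t ht => ht.1))
  · refine (ae_restrict_iff' measurableSet_Ioc).2 (ae_of_all _ fun t ht => ?_)
    have ht0 : 0 < t := ht.1
    have h0 := hh_nonneg γ ht0.le
    have hs := Real.sinh_nonneg_iff.2 ht0.le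
    rw [Real.norm_of_nonneg (by positivity)]
    have h1 := sinh_le_mul_cosh ht0.le
    have h2 : Real.cosh t ≤ Real.cosh R := by
      rw [Real.cosh_le_cosh, abs_of_pos ht0, abs_of_pos hR]; exact ht.2
    have h3 : Real.sinh t ≤ t * Real.cosh R := h1.trans (mul_le_mul_of_nonneg_left h2 ht0.le)
    calc t ^ 2 * (Real.sinh t * hh γ t) ≤ t ^ 2 * (t * Real.cosh R * hh γ t) := by gcongr
      _ = Real.cosh R * (t ^ 3 * hh γ t) := by ring
      _ ≤ Real.cosh R * (M * t ^ (-γ)) :=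
          mul_le_mul_of_nonneg_left (hb t ht0) (Real.cosh_pos R).le
      _ = _ := by ring

/-- The comparison function. -/
noncomputable def FF (γ t : ℝ) : ℝ := t * (Real.sinh t / Real.cosh t) * XX γ t

lemma FF_hasDerivAt {γ t : ℝ} (hγ : 0 < γ) (ht : 0 < t) :
    HasDerivAt (FF γ) ((Real.sinh t / Real.cosh t + t / Real.cosh t ^ 2) * XX γ t
      - t * (Real.sinh t / Real.cosh t) * (Real.sinh t * hh γ t)) t := by
  have hc := (Real.cosh_pos t).ne'
  have h := ((hasDerivAt_id t).mul ((Real.hasDerivAt_sinh t).div (Real.hasDerivAt_cosh t) hc)).mul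
    (XX_hasDerivAt hγ ht)
  refine h.congr_deriv ?_
  simp only [Pi.mul_apply, Pi.div_apply, id]
  have e : Real.cosh t * Real.cosh t - Real.sinh t * Real.sinh t = 1 := by
    have := Real.cosh_sq t; linarith
  rw [e]
  ring

lemma FF_deriv_le {γ t : ℝ} (hγ : 0 < γ) (hγ1 : γ < 1) (ht : 0 < t) :
    (Real.sinh t / Real.cosh t + t / Real.cosh t ^ 2) * XX γ t
      - t * (Real.sinh t / Real.cosh t) * (Real.sinh t * hh γ t) ≤
    ((1 - γ) / γ) * (t ^ 2 * (Real.sinh t * hh γ t)) := by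
  have hw := wilker ht.le
  have hk := kk_le hγ ht
  have hsc := sinh_le_mul_cosh ht.le
  have hc := Real.cosh_pos t
  have hs := Real.sinh_nonneg_iff.2 ht.le
  have hh0 := hh_nonneg γ ht.le
  unfold XX
  generalize Real.sinh t = s at *
  generalize Real.cosh t = c at *
  generalize hh γ t = h at *
  generalize kk γ t = k at *
  have hk' : k ≤ s * h / c := by rw [le_div_iff₀ hc]; linarith
  have hX : (1 / (2 * γ)) * (t * s * h + (t * c - s) * k) ≤
      (1 / (2 * γ)) * (s * h * (2 * t - s / c)) := by
    refine mul_le_mul_of_nonneg_left ?_ (by positivity)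
    have := mul_le_mul_of_nonneg_left hk' (by linarith : 0 ≤ t * c - s)
    calc _ ≤ t * s * h + (t * c - s) * (s * h / c) := by linarith
      _ = _ := by field_simp; ring
  have hA : (s / c + t / c ^ 2) * (2 * t - s / c) ≤ 2 * (t * (s / c)) := by
    have : 2 * (t * (s / c)) - (s / c + t / c ^ 2) * (2 * t - s / c) =
        (s ^ 2 * c + t * s - 2 * t ^ 2 * c) / c ^ 3 := by field_simp; ring
    have h2 : 0 ≤ (s ^ 2 * c + t * s - 2 * t ^ 2 * c) / c ^ 3 :=
      div_nonneg (by linarith) (by positivity)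
    linarith
  have hB : (s / c + t / c ^ 2) * ((1 / (2 * γ)) * (t * s * h + (t * c - s) * k)) ≤
      (1 / γ) * (t * (s / c)) * (s * h) := by
    calc _ ≤ (s / c + t / c ^ 2) * ((1 / (2 * γ)) * (s * h * (2 * t - s / c))) :=
          mul_le_mul_of_nonneg_left hX (by positivity)
      _ = (1 / (2 * γ)) * (s * h) * ((s / c + t / c ^ 2) * (2 * t - s / c)) := by ring
      _ ≤ (1 / (2 * γ)) * (s * h) * (2 * (t * (s / c))) :=
          mul_le_mul_of_nonneg_left hA (by positivity)
      _ = _ := by field_simp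
  have ht' : s / c ≤ t := by rw [div_le_iff₀ hc]; exact hsc
  calc _ ≤ (1 / γ) * (t * (s / c)) * (s * h) - t * (s / c) * (s * h) := by linarith
    _ = ((1 - γ) / γ) * ((t * (s / c)) * (s * h)) := by field_simp
    _ ≤ ((1 - γ) / γ) * ((t * t) * (s * h)) := by
        have : 0 ≤ (1 - γ) / γ := div_nonneg (by linarith) hγ.le
        gcongr
    _ = _ := by ring

lemma FF_tendsto {γ : ℝ} (hγ : 0 < γ) (hγ1 : γ < 1) : Tendsto (FF γ) (𝓝[>] 0) (𝓝 0) := by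
  obtain ⟨M, hM, hb⟩ := hh_small hγ hγ1
  have h1 : Tendsto (fun t : ℝ => (1 / γ * Real.cosh 1 * M) * t ^ (1 - γ)) (𝓝[>] 0) (𝓝 0) := by
    have : ContinuousAt (fun t : ℝ => (1 / γ * Real.cosh 1 * M) * t ^ (1 - γ)) 0 :=
      (Real.continuousAt_rpow_const 0 _ (Or.inr (by linarith))).const_mul _
    have h2 := this.tendsto
    simp only [Real.zero_rpow (by linarith : 1 - γ ≠ 0), mul_zero] at h2
    exact h2.mono_left nhdsWithin_le_nhds
  refine squeeze_zero' ?_ ?_ h1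
  · filter_upwards [self_mem_nhdsWithin] with t ht
    have ht0 : 0 < t := ht
    have h2 := XX_nonneg hγ ht0.le
    have h3 := Real.sinh_nonneg_iff.2 ht0.le
    have h4 := Real.cosh_pos t
    unfold FF
    positivity
  · filter_upwards [Ioo_mem_nhdsGT (zero_lt_one' ℝ)] with t ht
    have ht0 : 0 < t := ht.1
    have h0 := hh_nonneg γ ht0.le
    have hs := Real.sinh_nonneg_iff.2 ht0.le
    have hc := Real.cosh_pos t
    have hsc := sinh_le_mul_cosh ht0.le
    have h2 : Real.cosh t ≤ Real.cosh 1 := by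
      rw [Real.cosh_le_cosh, abs_of_pos ht0, abs_one]; exact ht.2.le
    have h3 : Real.sinh t ≤ t * Real.cosh 1 := hsc.trans (mul_le_mul_of_nonneg_left h2 ht0.le)
    have ht' : Real.sinh t / Real.cosh t ≤ t := by rw [div_le_iff₀ hc]; exact hsc
    have hX := XX_le hγ ht0
    have hXn := XX_nonneg hγ ht0.le
    have e : t ^ (1 - γ) = t * t ^ (-γ) := by
      rw [sub_eq_add_neg, Real.rpow_add ht0, Real.rpow_one]
    unfold FF
    calc _ ≤ t * t * ((1 / γ) * (t * (t * Real.cosh 1) * hh γ t)) := by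
          refine mul_le_mul (mul_le_mul_of_nonneg_left ht' ht0.le) (hX.trans ?_) hXn (by positivity)
          gcongr
      _ = 1 / γ * Real.cosh 1 * t * (t ^ 3 * hh γ t) := by ring
      _ ≤ 1 / γ * Real.cosh 1 * t * (M * t ^ (-γ)) :=
          mul_le_mul_of_nonneg_left (hb t ht0) (by have := Real.cosh_pos 1; positivity)
      _ = _ := by rw [e]; ring

lemma FF_le {γ R : ℝ} (hγ : 0 < γ) (hγ1 : γ < 1) (hR : 0 < R) :
    FF γ R ≤ ((1 - γ) / γ) * ∫ t in (0:ℝ)..R, t ^ 2 * (Real.sinh t * hh γ t) := by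
  have hF0 : FF γ 0 = 0 := by simp [FF]
  have h := intervalIntegral.sub_le_integral_of_hasDeriv_right_of_le (a := 0) (b := R) (g := FF γ)
    (φ := fun t => ((1 - γ) / γ) * (t ^ 2 * (Real.sinh t * hh γ t))) hR.le ?_
    (fun t ht => (FF_hasDerivAt hγ ht.1).hasDerivWithinAt)
    ((near_integrable hγ hγ1 hR).const_mul _)
    (fun t ht => FF_deriv_le hγ hγ1 ht.1)
  · rw [hF0, sub_zero, intervalIntegral.integral_const_mul] at h
    exact h
  · intro t ht
    rcases ht.1.eq_or_lt with h0 | h0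
    · rw [← h0]
      have h1 : ContinuousWithinAt (FF γ) (Ioi 0) 0 := by
        have := FF_tendsto hγ hγ1
        unfold ContinuousWithinAt
        rwa [hF0]
      have h2 : ContinuousWithinAt (FF γ) (Ici 0) 0 := by
        rw [← continuousWithinAt_Ioi_iff_Ici]; exact h1
      exact h2.mono Icc_subset_Ici_self
    · exact (FF_hasDerivAt hγ h0).continuousAt.continuousWithinAt

/-- The constant in front. -/
noncomputable def cc (γ : ℝ) : ℝ :=
  C3 γ * 2 / (Real.Gamma (3 / 2 + γ) * 2 ^ ((3 : ℝ) / 2 + γ))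

lemma cc_nonneg {γ : ℝ} (hγ : 0 < γ) : 0 ≤ cc γ := by
  have := Real.Gamma_pos_of_pos (s := 3 / 2 + γ) (by linarith)
  unfold cc C3
  positivity

lemma Kker_eq {γ t : ℝ} (ht : 0 < t) :
    Kker γ t * Real.sinh t ^ 2 = cc γ * (Real.sinh t * hh γ t) := by
  have hs : Real.sinh t ≠ 0 := (Real.sinh_pos_iff.2 ht).ne'
  unfold Kker cc hh
  rw [sq]
  calc _ = C3 γ * ((Real.sinh t)⁻¹ * Real.sinh t) * Real.sinh t * t ^ (-(1 / 2 : ℝ) - γ) *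
        (2 * besselK (3 / 2 + γ) t) /
        (Real.Gamma (3 / 2 + γ) * 2 ^ ((3 : ℝ) / 2 + γ)) := by ring
    _ = _ := by rw [inv_mul_cancel₀ hs]; ring

end ScaleAux

open ScaleAux in
/-- Lemma 5.4: `I_{∞,γ}(R) ≤ ((1−γ)/γ) 𝓗(R) I_{0,γ}(R)` with
`𝓗(R) = R coth R`. -/
theorem scaleIinf_le (γ : ℝ) (hγ : γ ∈ Set.Ioo (0 : ℝ) 1) (R : ℝ) (hR : 0 < R) :
    scaleIinf γ R ≤
      ((1 - γ) / γ) * (R * Real.cosh R / Real.sinh R) * scaleI0 γ R := by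
  obtain ⟨h0, h1⟩ := hγ
  have hP : ∫ ρ in Set.Ioi R, Kker γ ρ * (Real.sinh ρ) ^ 2 = cc γ * XX γ R := by
    rw [← tail_eq h0 hR, ← integral_const_mul]
    exact setIntegral_congr_fun measurableSet_Ioi fun t ht => Kker_eq (hR.trans ht)
  have hQ : ∫ ρ in (0 : ℝ)..R, ρ ^ 2 * Kker γ ρ * (Real.sinh ρ) ^ 2 =
      cc γ * ∫ t in (0 : ℝ)..R, t ^ 2 * (Real.sinh t * hh γ t) := by
    rw [← intervalIntegral.integral_const_mul, intervalIntegral.integral_of_le hR.le,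
      intervalIntegral.integral_of_le hR.le]
    refine setIntegral_congr_fun measurableSet_Ioc fun t ht => ?_
    have := Kker_eq (γ := γ) ht.1
    linear_combination t ^ 2 * this
  have hF := FF_le h0 h1 hR
  have hs := Real.sinh_pos_iff.2 hR
  have hc := Real.cosh_pos R
  have hcc := cc_nonneg h0
  unfold scaleIinf scaleI0
  rw [hP, hQ]
  generalize (∫ t in (0 : ℝ)..R, t ^ 2 * (Real.sinh t * hh γ t)) = Q at *
  have hpi := Real.pi_pos
  calc 4 * Real.pi * R ^ 2 * (cc γ * XX γ R)
      = 4 * Real.pi * cc γ * (R * Real.cosh R / Real.sinh R) * FF γ R := by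
        unfold FF; field_simp
    _ ≤ 4 * Real.pi * cc γ * (R * Real.cosh R / Real.sinh R) * ((1 - γ) / γ * Q) :=
        mul_le_mul_of_nonneg_left hF (by positivity)
    _ = _ := by ring
end
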